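/- Let n ≥ 2, β ≥ 0, 0 < δ < 1, C₀ > 1 and let χ be a cutoff. Assume α satisfies one of: (i) (n−3)/2 < β < (n−1)/2 and α ≤ 2β − (n−3)/2; or (ii) β ≥ (n−1)/2 and α < β + 1. Then there exists a constant C > 0 such that for every θ ∈ S^{n−1} and every Schwartz function q on ℝⁿ: ∫_{ℝⁿ} ⟨η⟩^{2α} | ∫_{{r > 0 : |1−r| < δ_k(η)}} ( S̃_{θ,1}(q)(η) − S̃_{θ,r}(q)(η) ) / (1−r) dr |² dη ≤ C δ² ‖q‖⁴_{W^{β,2}_2}, where δ_k(η) := δ · min( k(η,θ)^{−2}, 1 ) for η ∈ H_θ (and the inner integral is taken to be 0 when η ∉ H_θ). -/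

import Mathlib

open MeasureTheory Real Filter Set Metric
open scoped FourierTransform RealInnerProductSpace SchwartzMap ENNReal

noncomputable section

abbrev En (n : ℕ) := EuclideanSpace ℝ (Fin n)

/-- Japanese bracket `⟨x⟩ = (1+|x|²)^{1/2}`. -/
def jap {n : ℕ} (x : En n) : ℝ := Real.sqrt (1 + ‖x‖ ^ 2)

/-- `k(η,θ) = -|η|²/(θ·η)`. -/
def kval {n : ℕ} (θ η : En n) : ℝ := -‖η‖ ^ 2 / ⟪θ, η⟫

/-- The Ewald sphere `Γ_r(-2kθ)`, of center `-kθ` and radius `rk`. -/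
def ewald {n : ℕ} (θ η : En n) (r : ℝ) : Set (En n) :=
  Metric.sphere (-(kval θ η • θ)) (r * kval θ η)

/-- The spherical operator `S_{θ,r}`. -/
def Sop {n : ℕ} (θ : En n) (r : ℝ) (q : En n → ℂ) (η : En n) : ℂ :=
  if ⟪η, θ⟫ < 0 then
    ((kval θ η * (r + 1))⁻¹ : ℝ) •
      ∫ ξ in ewald θ η r, 𝓕 q ξ * 𝓕 q (η - ξ) ∂μH[(n : ℝ) - 1]
  else 0

/-- The operator `K_r(g₁,g₂)`. -/
def Kop {n : ℕ} {G₁ G₂ : Type*} [NormedAddCommGroup G₁] [NormedAddCommGroup G₂]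
    (θ : En n) (r : ℝ) (g₁ : En n → G₁) (g₂ : En n → G₂) (η : En n) : ℝ :=
  if ⟪η, θ⟫ < 0 then
    (kval θ η)⁻¹ * ∫ ξ in ewald θ η r, ‖g₁ ξ‖ * ‖g₂ (η - ξ)‖ ∂μH[(n : ℝ) - 1]
  else 0

/-- Weighted norm `‖F‖_{L²_α}`. -/
def L2w {n : ℕ} {G : Type*} [NormedAddCommGroup G] (α : ℝ) (F : En n → G) : ℝ :=
  (∫ η, jap η ^ (2 * α) * ‖F η‖ ^ 2) ^ (1/2 : ℝ)

/-- Weighted Sobolev norm `‖q‖_{W^{β,2}_δ} = ‖⟨·⟩^δ 𝓕⁻¹(⟨·⟩^β 𝓕q)‖_{L²}`. -/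
def sobNorm {n : ℕ} (β δ : ℝ) (q : En n → ℂ) : ℝ :=
  (∫ x, jap x ^ (2 * δ) * ‖𝓕⁻ (fun ξ => (jap ξ ^ β : ℝ) • 𝓕 q ξ) x‖ ^ 2) ^ (1/2 : ℝ)

/-- A smooth radial cutoff vanishing for `|ξ| < C₀` and equal to `1` for `|ξ| > 2C₀`. -/
structure IsCutoff {n : ℕ} (C₀ : ℝ) (χ : En n → ℝ) : Prop where
  smooth : ContDiff ℝ (⊤ : ℕ∞) χ
  mem_Icc : ∀ ξ, χ ξ ∈ Set.Icc (0 : ℝ) 1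
  eq_one : ∀ ξ : En n, 2 * C₀ < ‖ξ‖ → χ ξ = 1
  eq_zero : ∀ ξ : En n, ‖ξ‖ < C₀ → χ ξ = 0


open scoped NNReal Pointwise LineDeriv

def embF {m : ℕ} (i : Fin (m+1)) (ε : ℝ) (y : Fin m → ℝ) : En (m+1) :=
  WithLp.toLp 2 (i.insertNth (α := fun _ => ℝ) ε y)

lemma embF_self {m : ℕ} (i : Fin (m+1)) (ε : ℝ) (y : Fin m → ℝ) : embF i ε y i = ε := by
  simp [embF]

lemma embF_succAbove {m : ℕ} (i : Fin (m+1)) (ε : ℝ) (y : Fin m → ℝ) (j : Fin m) :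
    embF i ε y (i.succAbove j) = y j := by
  simp [embF]

lemma embF_ne {m : ℕ} (i : Fin (m+1)) {ε : ℝ} (hε : ε ≠ 0) (y : Fin m → ℝ) : embF i ε y ≠ 0 := by
  intro h
  have := embF_self i ε y
  rw [h] at this
  exact hε (by simpa using this.symm)

lemma embF_contDiff {m : ℕ} (i : Fin (m+1)) (ε : ℝ) : ContDiff ℝ 1 (embF i ε) := by
  rw [contDiff_euclidean]
  intro l
  induction l using i.succAboveCases with
  | x => simp only [embF_self]; exact contDiff_const
  | p j => simp only [embF_succAbove]; exact contDiff_apply ℝ ℝ j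

def chartF {m : ℕ} (i : Fin (m+1)) (ε : ℝ) (y : Fin m → ℝ) : En (m+1) :=
  ‖embF i ε y‖⁻¹ • embF i ε y

lemma chartF_contDiff {m : ℕ} (i : Fin (m+1)) {ε : ℝ} (hε : ε ≠ 0) : ContDiff ℝ 1 (chartF i ε) := by
  unfold chartF
  refine ContDiff.smul (ContDiff.inv ((embF_contDiff i ε).norm ℝ (embF_ne i hε)) ?_)
    (embF_contDiff i ε)
  intro y
  exact norm_ne_zero_iff.2 (embF_ne i hε y)

lemma embF_norm_le {m : ℕ} (i : Fin (m+1)) {ε : ℝ} (hε : ε = 1 ∨ ε = -1) (y : Fin m → ℝ)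
    (hy : y ∈ Icc (-1 : Fin m → ℝ) 1) : ‖embF i ε y‖ ≤ m + 1 := by
  have h1 : ‖embF i ε y‖ ^ 2 ≤ (m + 1 : ℝ) ^ 2 := by
    rw [EuclideanSpace.norm_sq_eq, Fin.sum_univ_succAbove _ i]
    simp only [embF_self, embF_succAbove, Real.norm_eq_abs, sq_abs]
    have : ∑ j : Fin m, y j ^ 2 ≤ ∑ j : Fin m, (1 : ℝ) := by
      refine Finset.sum_le_sum fun j _ => ?_
      have h1 := hy.1 j
      have h2 := hy.2 j
      simp at h1 h2
      nlinarith
    simp at this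
    have h3 : ε ^ 2 = 1 := by rcases hε with rfl | rfl <;> norm_num
    rw [h3]
    have : (0 : ℝ) ≤ m := by positivity
    nlinarith
  exact le_of_sq_le_sq h1 (by positivity)

lemma cone_vol {m : ℕ} (i : Fin (m+1)) {ε : ℝ} (hε : ε = 1 ∨ ε = -1) (E : Set (En (m+1)))
    (hE : MeasurableSet E) :
    ENNReal.ofReal ((2 * (m + 1) : ℝ)⁻¹ ^ (m + 1)) * volume (Icc (-1 : Fin m → ℝ) 1 ∩ chartF i ε ⁻¹' E)
      ≤ volume (Ioo (0 : ℝ) 1 • E) := by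
  set U := Icc (-1 : Fin m → ℝ) 1 ∩ chartF i ε ⁻¹' E with hU
  set c : ℝ := ((m : ℝ) + 1)⁻¹ with hc
  have hcpos : 0 < c := by positivity
  have hε0 : ε ≠ 0 := by rcases hε with rfl | rfl <;> norm_num
  have hεε : ε * ε = 1 := by rcases hε with rfl | rfl <;> norm_num
  have hUm : MeasurableSet U :=
    measurableSet_Icc.inter ((chartF_contDiff i hε0).continuous.measurable hE)
  set J : Set ℝ := (fun t => ε * t) ⁻¹' Ioo (c/2) c with hJ
  have hJm : MeasurableSet J := (measurable_const_mul ε) measurableSet_Ioo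
  set W : Set (ℝ × (Fin m → ℝ)) := {p | p.1 ∈ J ∧ (ε * p.1)⁻¹ • p.2 ∈ U} with hW
  have hWm : MeasurableSet W := by
    refine (measurable_fst hJm).inter ?_
    have : Measurable (fun p : ℝ × (Fin m → ℝ) => (ε * p.1)⁻¹ • p.2) := by fun_prop
    exact this hUm
  have h1 : ENNReal.ofReal ((2 * (m + 1) : ℝ)⁻¹ ^ (m + 1)) * volume U ≤ volume W := by
    rw [Measure.volume_eq_prod, Measure.prod_apply hWm]
    have hJv : volume J = ENNReal.ofReal (c / 2) := by
      rw [hJ, Real.volume_preimage_mul_left hε0, Real.volume_Ioo]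
      have : |ε⁻¹| = 1 := by rcases hε with rfl | rfl <;> norm_num
      rw [this]; simp
      congr 1; ring
    calc ENNReal.ofReal ((2 * (m + 1) : ℝ)⁻¹ ^ (m + 1)) * volume U
        = ∫⁻ t in J, ENNReal.ofReal ((c/2)^m) * volume U := by
          rw [setLIntegral_const, hJv]
          have : (2 * (m + 1) : ℝ)⁻¹ = c / 2 := by rw [hc]; field_simp
          rw [this, pow_succ, ENNReal.ofReal_mul (by positivity)]
          ring
      _ ≤ ∫⁻ t in J, volume (Prod.mk t ⁻¹' W) := by
          refine setLIntegral_mono' hJm fun t ht => ?_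
          have htpos : 0 < ε * t := lt_trans (by positivity) ht.1
          have : (ε * t) • U ⊆ Prod.mk t ⁻¹' W := by
            rintro z ⟨u, hu, rfl⟩
            refine ⟨ht, ?_⟩
            change (ε * t)⁻¹ • ((ε * t) • u) ∈ U
            rwa [smul_smul, inv_mul_cancel₀ htpos.ne', one_smul]
          refine le_trans ?_ (measure_mono this)
          rw [Measure.addHaar_smul]
          gcongr
          simp only [Module.finrank_fintype_fun_eq_card, Fintype.card_fin]
          rw [abs_of_pos (by positivity)]
          exact pow_le_pow_left₀ (by positivity) ht.1.le _
      _ ≤ ∫⁻ t, volume (Prod.mk t ⁻¹' W) := setLIntegral_le_lintegral _ _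
  refine h1.trans ?_
  have e1 := volume_preserving_piFinSuccAbove (fun _ : Fin (m + 1) => ℝ) i
  have e2 := PiLp.volume_preserving_ofLp (Fin (m+1))
  have e3 := e1.comp e2
  rw [← e3.measure_preimage hWm.nullMeasurableSet]
  refine measure_mono ?_
  intro x hx
  obtain ⟨hx1, hx2⟩ := hx
  simp only [Function.comp, MeasurableEquiv.piFinSuccAbove_apply] at hx1 hx2
  simp only [Fin.insertNthEquiv_symm_apply] at hx1 hx2
  have htpos : 0 < ε * x i := lt_trans (by positivity) hx1.1
  set y : Fin m → ℝ := (ε * x i)⁻¹ • i.removeNth x.ofLp with hy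
  have hxe : x = (ε * x i) • embF i ε y := by
    ext l
    induction l using i.succAboveCases with
    | x => simp [embF_self]; linear_combination (-(x i)) * hεε
    | p j =>
      simp only [PiLp.smul_apply, embF_succAbove, hy, Pi.smul_apply, smul_eq_mul, Fin.removeNth]
      rw [← mul_assoc, mul_inv_cancel₀ htpos.ne', one_mul]
  have hn0 : 0 < ‖embF i ε y‖ := norm_pos_iff.2 (embF_ne i hε0 y)
  refine ⟨(ε * x i) * ‖embF i ε y‖, ⟨by positivity, ?_⟩, chartF i ε y, hx2.2, ?_⟩
  · have := embF_norm_le i hε y hx2.1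
    calc (ε * x i) * ‖embF i ε y‖ < c * (m + 1) := by
          apply mul_lt_mul hx1.2 this hn0 hcpos.le
      _ = 1 := by rw [hc]; field_simp
  · simp only [chartF, smul_smul]
    rw [mul_assoc, mul_inv_cancel₀ hn0.ne', mul_one, ← hxe]

lemma exists_chart {m : ℕ} (x : En (m+1)) (hx : ‖x‖ = 1) :
    ∃ i : Fin (m+1), ∃ ε : ℝ, (ε = 1 ∨ ε = -1) ∧ ∃ y ∈ Icc (-1 : Fin m → ℝ) 1, chartF i ε y = x := by
  obtain ⟨i, -, hi⟩ := Finset.exists_max_image Finset.univ (fun i => |x i|) Finset.univ_nonempty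
  have hi0 : 0 < |x i| := by
    by_contra h
    have h0 : x = 0 := by
      ext j
      have := hi j (Finset.mem_univ j)
      have h2 : |x j| = 0 := le_antisymm (by linarith) (abs_nonneg _)
      simpa using h2
    simp [h0] at hx
  refine ⟨i, x i / |x i|, ?_, |x i|⁻¹ • i.removeNth x.ofLp, ?_, ?_⟩
  · rcases lt_trichotomy (x i) 0 with h | h | h
    · right; rw [abs_of_neg h, div_neg, div_self h.ne]
    · simp [h] at hi0
    · left; rw [abs_of_pos h]; field_simp
  · have key : ∀ j, |(|x i|⁻¹ • i.removeNth x.ofLp) j| ≤ 1 := by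
      intro j
      simp only [Pi.smul_apply, smul_eq_mul, Fin.removeNth, abs_mul, abs_inv, abs_abs]
      have := hi (i.succAbove j) (Finset.mem_univ _)
      rw [inv_mul_le_one₀ hi0]
      exact this
    exact ⟨fun j => (abs_le.1 (key j)).1, fun j => (abs_le.1 (key j)).2⟩
  · have h : embF i (x i / |x i|) (|x i|⁻¹ • i.removeNth x.ofLp) = |x i|⁻¹ • x := by
      ext l
      induction l using i.succAboveCases with
      | x => simp [embF_self]; field_simp
      | p j => simp [embF_succAbove, Fin.removeNth]
    rw [chartF, h, norm_smul, hx, smul_smul]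
    simp [hi0.ne']

lemma hausdorff_le_cone (m : ℕ) : ∃ C : ℝ≥0∞, C ≠ ∞ ∧ ∀ E : Set (En (m+1)), E ⊆ sphere 0 1 →
    MeasurableSet E → μH[(m : ℝ)] E ≤ C * volume (Ioo (0 : ℝ) 1 • E) := by
  have hL : ∀ i : Fin (m+1), ∀ ε : ℝ, ∃ K : ℝ≥0, ε ≠ 0 →
      LipschitzOnWith K (chartF i ε) (Icc (-1 : Fin m → ℝ) 1) := by
    intro i ε
    by_cases hε : ε = 0
    · exact ⟨0, fun h => absurd hε h⟩
    · obtain ⟨K, hK⟩ := (chartF_contDiff i hε).locallyLipschitz.locallyLipschitzOn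
        (s := Icc (-1 : Fin m → ℝ) 1) |>.exists_lipschitzOnWith_of_compact isCompact_Icc
      exact ⟨K, fun _ => hK⟩
  choose K hK using hL
  set a := ENNReal.ofReal ((2 * (m + 1) : ℝ)⁻¹ ^ (m + 1)) with ha
  have ha0 : a ≠ 0 := by
    rw [ha, Ne, ENNReal.ofReal_eq_zero, not_le]; positivity
  have hat : a ≠ ∞ := ENNReal.ofReal_ne_top
  have hpiece : ∀ i : Fin (m+1), ∀ ε : ℝ, (ε = 1 ∨ ε = -1) → ∀ E : Set (En (m+1)),
      MeasurableSet E → μH[(m : ℝ)] (chartF i ε '' (Icc (-1 : Fin m → ℝ) 1 ∩ chartF i ε ⁻¹' E)) ≤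
        ((K i ε : ℝ≥0∞) ^ (m : ℝ) * a⁻¹) * volume (Ioo (0 : ℝ) 1 • E) := by
    intro i ε hε E hE
    have hε0 : ε ≠ 0 := by rcases hε with rfl | rfl <;> norm_num
    have h1 := ((hK i ε hε0).mono inter_subset_left (s := Icc (-1 : Fin m → ℝ) 1 ∩ chartF i ε ⁻¹' E)).hausdorffMeasure_image_le
      (d := (m : ℝ)) (by positivity)
    refine h1.trans ?_
    have h2 : (μH[(m : ℝ)] : Measure (Fin m → ℝ)) = volume := by
      have := hausdorffMeasure_pi_real (ι := Fin m)
      simpa using this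
    rw [h2, mul_assoc]
    gcongr
    have h3 := cone_vol i hε E hE
    rw [← ha] at h3
    calc _ = a⁻¹ * (a * volume (Icc (-1 : Fin m → ℝ) 1 ∩ chartF i ε ⁻¹' E)) := by
          rw [← mul_assoc, ENNReal.inv_mul_cancel ha0 hat, one_mul]
      _ ≤ _ := by gcongr
  refine ⟨∑ i : Fin (m+1), (((K i 1 : ℝ≥0∞) ^ (m : ℝ) * a⁻¹) + ((K i (-1) : ℝ≥0∞) ^ (m : ℝ) * a⁻¹)), ?_, ?_⟩
  · rw [ENNReal.sum_ne_top]
    intro i _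
    rw [ENNReal.add_ne_top]
    constructor <;> refine ENNReal.mul_ne_top (ENNReal.rpow_ne_top_of_nonneg (by positivity) (by simp)) (by simp [ha0])
  · intro E hE hEm
    have hsub : E ⊆ ⋃ i : Fin (m+1), ((chartF i 1 '' (Icc (-1 : Fin m → ℝ) 1 ∩ chartF i 1 ⁻¹' E)) ∪
        (chartF i (-1) '' (Icc (-1 : Fin m → ℝ) 1 ∩ chartF i (-1) ⁻¹' E))) := by
      intro x hx
      obtain ⟨i, ε, hε, y, hy, hxy⟩ := exists_chart x (by simpa using hE hx)
      rw [mem_iUnion]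
      refine ⟨i, ?_⟩
      rcases hε with rfl | rfl
      · left; exact ⟨y, ⟨hy, by simpa [hxy] using hx⟩, hxy⟩
      · right; exact ⟨y, ⟨hy, by simpa [hxy] using hx⟩, hxy⟩
    refine (measure_mono hsub).trans ((measure_iUnion_fintype_le _ _).trans ?_)
    rw [Finset.sum_mul]
    refine Finset.sum_le_sum fun i _ => ?_
    refine (measure_union_le _ _).trans ?_
    rw [add_mul]
    gcongr
    · exact hpiece i 1 (Or.inl rfl) E hEm
    · exact hpiece i (-1) (Or.inr rfl) E hEm

lemma polar_lintegral (m : ℕ) (H : En (m+1) → ℝ≥0∞) (hH : Measurable H) :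
    ∫⁻ ω, (∫⁻ s in Ioi (0:ℝ), ENNReal.ofReal (s ^ m) * H (s • (ω : En (m+1))))
      ∂(volume : Measure (En (m+1))).toSphere = ∫⁻ x, H x := by
  have hdim : Module.finrank ℝ (En (m+1)) - 1 = m := by simp
  have h1 : ∫⁻ x, H x = ∫⁻ x : ({(0)}ᶜ : Set (En (m+1))), H x ∂((volume : Measure (En (m+1))).comap (Subtype.val)) := by
    rw [lintegral_subtype_comap (measurableSet_singleton _).compl, restrict_compl_singleton]
  have h2 : ∫⁻ x : ({(0)}ᶜ : Set (En (m+1))), H x ∂((volume : Measure (En (m+1))).comap (Subtype.val)) =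
      ∫⁻ p, H ((p.2 : ℝ) • (p.1 : En (m+1))) ∂(volume : Measure (En (m+1))).toSphere.prod
        (.volumeIoiPow (Module.finrank ℝ (En (m+1)) - 1)) := by
    rw [← (volume : Measure (En (m+1))).measurePreserving_homeomorphUnitSphereProd.lintegral_comp_emb
      (Homeomorph.measurableEmbedding _)]
    refine lintegral_congr fun x => ?_
    congr 1
    have h0 : ‖(x : En (m+1))‖ ≠ 0 := norm_ne_zero_iff.2 x.2
    simp [smul_smul, h0]
  rw [h1, h2, hdim, lintegral_prod]
  · refine lintegral_congr fun ω => ?_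
    rw [Measure.volumeIoiPow, lintegral_withDensity_eq_lintegral_mul]
    · simp only [Pi.mul_apply]
      rw [lintegral_subtype_comap measurableSet_Ioi (fun s : ℝ => ENNReal.ofReal (s ^ m) * H (s • (ω : En (m+1))))]
    · fun_prop
    · exact hH.comp (by fun_prop)
  · exact (hH.comp (by fun_prop)).aemeasurable

lemma hausdorff_restrict_le (m : ℕ) : ∃ C : ℝ≥0∞, C ≠ ∞ ∧
    (μH[(m : ℝ)] : Measure (En (m+1))).restrict (sphere 0 1) ≤
      C • ((volume : Measure (En (m+1))).toSphere.map (Subtype.val)) := by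
  obtain ⟨C, hC, h⟩ := hausdorff_le_cone m
  refine ⟨C, hC, ?_⟩
  rw [Measure.le_iff]
  intro E hE
  have hSm : MeasurableSet (sphere (0 : En (m+1)) 1) := isClosed_sphere.measurableSet
  rw [Measure.restrict_apply hE, Measure.smul_apply, Measure.map_apply measurable_subtype_coe hE,
    Measure.toSphere_apply' _ (measurable_subtype_coe hE)]
  refine (h _ inter_subset_right (hE.inter hSm)).trans ?_
  rw [smul_eq_mul]
  gcongr
  rw [Subtype.image_preimage_coe, inter_comm]
  refine le_mul_of_one_le_left (by positivity) ?_
  simp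

lemma hausdorff_sphere_lt_top (m : ℕ) : μH[(m : ℝ)] (sphere (0 : En (m+1)) 1) < ∞ := by
  obtain ⟨C, hC, h⟩ := hausdorff_le_cone m
  refine (h _ subset_rfl isClosed_sphere.measurableSet).trans_lt ?_
  refine ENNReal.mul_lt_top hC.lt_top ?_
  refine (measure_mono (t := closedBall 0 1) ?_).trans_lt measure_closedBall_lt_top
  rintro _ ⟨t, ht, x, hx, rfl⟩
  simp at hx
  simp [norm_smul, hx, abs_of_pos ht.1, ht.2.le]

lemma polar_ineq (m : ℕ) (δ : ℝ) (hδ1 : δ < 1) : ∃ C : ℝ≥0∞, C ≠ ∞ ∧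
    ∀ H : En (m+1) → ℝ≥0∞, Measurable H →
      ∫⁻ ω in sphere (0 : En (m+1)) 1, (∫⁻ s in Icc (1 - δ) (1 + δ), H (s • ω)) ∂μH[(m : ℝ)] ≤
        C * ∫⁻ x, H x := by
  obtain ⟨C, hC, h⟩ := hausdorff_restrict_le m
  set a := ENNReal.ofReal ((1 - δ) ^ m) with ha
  have ha0 : a ≠ 0 := by
    rw [ha, Ne, ENNReal.ofReal_eq_zero, not_le]; have : 0 < 1 - δ := by linarith
    positivity
  have hat : a ≠ ∞ := ENNReal.ofReal_ne_top
  refine ⟨C * a⁻¹, ENNReal.mul_ne_top hC (by simp [ha0]), fun H hH => ?_⟩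
  have hmeas : Measurable fun p : En (m+1) × ℝ => H (p.2 • p.1) := hH.comp (by fun_prop)
  calc _ ≤ ∫⁻ ω, (∫⁻ s in Icc (1 - δ) (1 + δ), H (s • ω))
          ∂(C • ((volume : Measure (En (m+1))).toSphere.map (Subtype.val))) :=
        lintegral_mono' h le_rfl
    _ = C * ∫⁻ ω, (∫⁻ s in Icc (1 - δ) (1 + δ), H (s • (ω : En (m+1))))
          ∂((volume : Measure (En (m+1))).toSphere) := by
        rw [lintegral_smul_measure, lintegral_map, smul_eq_mul]
        · exact hmeas.lintegral_prod_right'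
        · exact measurable_subtype_coe
    _ ≤ C * ∫⁻ ω, a⁻¹ * (∫⁻ s in Ioi (0:ℝ), ENNReal.ofReal (s ^ m) * H (s • (ω : En (m+1))))
          ∂((volume : Measure (En (m+1))).toSphere) := by
        gcongr with ω
        rw [← lintegral_const_mul' _ _ (by simp [ha0])]
        refine le_trans ?_ (lintegral_mono_set (s := Icc (1 - δ) (1 + δ)) ?_)
        · refine setLIntegral_mono' measurableSet_Icc fun s hs => ?_
          rw [← mul_assoc]
          refine le_mul_of_one_le_left (by positivity) ?_
          calc 1 = a⁻¹ * a := (ENNReal.inv_mul_cancel ha0 hat).symm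
            _ ≤ _ := by
              rw [ha]; gcongr
              exact hs.1
        · intro s hs
          have := hs.1
          simp only [mem_Ioi]; linarith
    _ = _ := by
        rw [lintegral_const_mul' _ _ (by simp [ha0]), polar_lintegral m H hH, mul_assoc]

lemma sphere_integral_scale (m : ℕ) (c : En (m+1)) {R : ℝ} (hR : 0 < R) (f : En (m+1) → ℂ) :
    ∫ ξ in sphere c R, f ξ ∂μH[(m : ℝ)] =
      ((R ^ m : ℝ)) • ∫ ω in sphere (0 : En (m+1)) 1, f (c + R • ω) ∂μH[(m : ℝ)] := by
  set e : En (m+1) ≃ₜ En (m+1) := (Homeomorph.smulOfNeZero R hR.ne').trans (Homeomorph.addLeft c) with he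
  have hea : ∀ x, e x = c + R • x := fun x => rfl
  have hmap : (μH[(m : ℝ)] : Measure (En (m+1))) = (R.toNNReal ^ m) • Measure.map e μH[(m : ℝ)] := by
    ext s hs
    rw [Measure.smul_apply, Measure.map_apply e.measurable hs]
    have h1 : e ⁻¹' s = R⁻¹ • ((IsometryEquiv.addLeft c) ⁻¹' s) := by
      ext x
      rw [Set.mem_inv_smul_set_iff₀ hR.ne']
      rfl
    rw [h1, Measure.hausdorffMeasure_smul₀ (by positivity) (inv_ne_zero hR.ne'),
      IsometryEquiv.hausdorffMeasure_preimage, smul_smul]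
    have : R.toNNReal ^ m * ‖R⁻¹‖₊ ^ (m : ℝ) = 1 := by
      have h2 : ‖R⁻¹‖₊ = R.toNNReal⁻¹ := by
        ext; simp [abs_of_pos hR, hR.le]
      rw [h2, NNReal.rpow_natCast, ← mul_pow, mul_inv_cancel₀, one_pow]
      simpa using hR
    rw [this, one_smul]
  conv_lhs => rw [hmap]
  rw [Measure.restrict_smul, integral_smul_nnreal_measure,
    e.measurableEmbedding.setIntegral_map]
  have : e ⁻¹' sphere c R = sphere 0 1 := by
    ext x
    simp [hea, norm_smul, abs_of_pos hR, hR.ne']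
  rw [this, NNReal.smul_def]
  simp [hea, hR.le]

def Nf {n : ℕ} (h : En n → ℂ) (ξ : En n) : ℝ :=
  ‖h ξ‖ + ‖fderiv ℝ h ξ‖ + ‖fderiv ℝ (fderiv ℝ h) ξ‖

lemma jap_rpow {n : ℕ} (x : En n) (s : ℝ) : jap x ^ s = (1 + ‖x‖ ^ 2) ^ (s / 2) := by
  rw [jap, Real.sqrt_eq_rpow, ← Real.rpow_mul (by positivity)]
  congr 1; ring

lemma hasFDerivAt_J {E : Type*} [NormedAddCommGroup E] [InnerProductSpace ℝ E] (s : ℝ) (x : E) :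
    HasFDerivAt (fun x : E => (1 + ‖x‖ ^ 2) ^ s)
      ((2 * s * (1 + ‖x‖ ^ 2) ^ (s - 1)) • innerSL ℝ x) x := by
  have h1 : HasFDerivAt (fun x : E => 1 + ‖x‖ ^ 2) (2 • innerSL ℝ x) x := by
    have := (hasStrictFDerivAt_norm_sq x).hasFDerivAt.const_add (1 : ℝ)
    exact this
  have h2 := h1.rpow_const (p := s) (Or.inl (by positivity))
  convert h2 using 1
  ext v
  simp
  ring

lemma fderiv_J {E : Type*} [NormedAddCommGroup E] [InnerProductSpace ℝ E] (s : ℝ) : fderiv ℝ (fun x : E => (1 + ‖x‖ ^ 2) ^ s) =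
    fun x => (2 * s * (1 + ‖x‖ ^ 2) ^ (s - 1)) • innerSL ℝ x :=
  funext fun x => (hasFDerivAt_J s x).fderiv

lemma norm_innerSL' {E : Type*} [NormedAddCommGroup E] [InnerProductSpace ℝ E] : ‖(innerSL ℝ : E →L[ℝ] E →L[ℝ] ℝ)‖ ≤ 1 :=
  norm_innerSL_le ℝ

lemma fderiv_J_le {E : Type*} [NormedAddCommGroup E] [InnerProductSpace ℝ E] (s : ℝ) (x : E) :
    ‖fderiv ℝ (fun x : E => (1 + ‖x‖ ^ 2) ^ s) x‖ ≤ 2 * |s| * (1 + ‖x‖ ^ 2) ^ s := by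
  rw [fderiv_J]
  simp only [norm_smul, innerSL_apply_norm, norm_mul, Real.norm_eq_abs]
  have hpos : 0 < 1 + ‖x‖ ^ 2 := by positivity
  have h1 : (1 + ‖x‖ ^ 2) ^ s = (1 + ‖x‖ ^ 2) ^ (s - 1) * (1 + ‖x‖ ^ 2) := by
    rw [← Real.rpow_add_one hpos.ne']; congr 1; ring
  rw [h1, abs_of_pos (Real.rpow_pos_of_pos hpos _)]
  have : ‖x‖ ≤ 1 + ‖x‖ ^ 2 := by nlinarith [sq_nonneg (‖x‖ - 1)]
  simp only [abs_two]
  rw [mul_assoc]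
  gcongr

lemma fderiv2_J_le {E : Type*} [NormedAddCommGroup E] [InnerProductSpace ℝ E] (s : ℝ) (x : E) :
    ‖fderiv ℝ (fderiv ℝ (fun x : E => (1 + ‖x‖ ^ 2) ^ s)) x‖ ≤
      (2 * |s| + 4 * |s| * |s - 1|) * (1 + ‖x‖ ^ 2) ^ s := by
  have hpos : 0 < 1 + ‖x‖ ^ 2 := by positivity
  have hd : HasFDerivAt (fun x : E => (2 * s * (1 + ‖x‖ ^ 2) ^ (s - 1)) • innerSL ℝ x) _ x :=
    ((hasFDerivAt_J (s - 1) x).const_mul (2 * s)).smul (innerSL ℝ : E →L[ℝ] E →L[ℝ] ℝ).hasFDerivAt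
  rw [fderiv_J, hd.fderiv]
  have hA : (0:ℝ) ≤ (1 + ‖x‖ ^ 2) ^ (s - 1) := by positivity
  have h1 : (1 + ‖x‖ ^ 2) ^ s = (1 + ‖x‖ ^ 2) ^ (s - 1) * (1 + ‖x‖ ^ 2) := by
    rw [← Real.rpow_add_one hpos.ne']; congr 1; ring
  have h2 : (1 + ‖x‖ ^ 2) ^ (s - 1) = (1 + ‖x‖ ^ 2) ^ (s - 1 - 1) * (1 + ‖x‖ ^ 2) := by
    rw [← Real.rpow_add_one hpos.ne']; congr 1; ring
  have hB : (0:ℝ) ≤ (1 + ‖x‖ ^ 2) ^ (s - 1 - 1) := by positivity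
  refine (norm_add_le (_ : E →L[ℝ] E →L[ℝ] ℝ) _).trans ?_
  refine (add_le_add (ContinuousLinearMap.opNorm_smul_le _ _) le_rfl).trans ?_
  rw [ContinuousLinearMap.norm_smulRight_apply, norm_smul, norm_smul, innerSL_apply_norm]
  simp only [norm_mul, Real.norm_eq_abs, abs_two, abs_of_nonneg hA, abs_of_nonneg hB]
  have e1 : 2 * |s| * (1 + ‖x‖ ^ 2) ^ (s - 1) * ‖(innerSL ℝ : E →L[ℝ] E →L[ℝ] ℝ)‖ ≤
      2 * |s| * (1 + ‖x‖ ^ 2) ^ s := by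
    rw [h1]
    have := norm_innerSL' (E := E)
    have h3 : (1 + ‖x‖ ^ 2) ^ (s - 1) * ‖(innerSL ℝ : E →L[ℝ] E →L[ℝ] ℝ)‖ ≤
      (1 + ‖x‖ ^ 2) ^ (s - 1) * (1 + ‖x‖ ^ 2) := by
      gcongr; nlinarith [sq_nonneg ‖x‖]
    rw [mul_assoc]; gcongr
  have e2 : 2 * |s| * (2 * |s - 1| * (1 + ‖x‖ ^ 2) ^ (s - 1 - 1) * ‖x‖) * ‖x‖ ≤
      4 * |s| * |s - 1| * (1 + ‖x‖ ^ 2) ^ s := by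
    rw [h1, h2]
    have h3 : ‖x‖ * ‖x‖ ≤ (1 + ‖x‖ ^ 2) * (1 + ‖x‖ ^ 2) := by nlinarith [sq_nonneg ‖x‖, sq_nonneg (‖x‖^2)]
    calc _ = 4 * |s| * |s - 1| * ((1 + ‖x‖ ^ 2) ^ (s - 1 - 1) * (‖x‖ * ‖x‖)) := by ring
      _ ≤ 4 * |s| * |s - 1| * ((1 + ‖x‖ ^ 2) ^ (s - 1 - 1) * ((1 + ‖x‖ ^ 2) * (1 + ‖x‖ ^ 2))) := by gcongr
      _ = _ := by ring
  calc _ ≤ 2 * |s| * (1 + ‖x‖ ^ 2) ^ s + 4 * |s| * |s - 1| * (1 + ‖x‖ ^ 2) ^ s := by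
        refine add_le_add e1 ?_
        convert e2 using 1
    _ = _ := by ring

lemma norm_it2 {n : ℕ} {G : Type*} [NormedAddCommGroup G] [NormedSpace ℝ G] (h : En n → G) (ξ : En n) :
    ‖iteratedFDeriv ℝ 2 h ξ‖ = ‖fderiv ℝ (fderiv ℝ h) ξ‖ := by
  rw [← norm_iteratedFDeriv_one, norm_iteratedFDeriv_fderiv]

lemma Nf_mul_le {n : ℕ} (s : ℝ) (g : En n → ℂ) (hg : ContDiff ℝ 2 g) (ξ : En n) :
    Nf (fun ξ => ((1 + ‖ξ‖ ^ 2) ^ s : ℝ) • g ξ) ξ ≤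
      (1 + 6 * |s| + (2 * |s| + 4 * |s| * |s - 1|) + 1 + 1) * (1 + ‖ξ‖ ^ 2) ^ s * Nf g ξ := by
  have hJ : ContDiff ℝ 2 (fun x : En n => (1 + ‖x‖ ^ 2) ^ s) :=
    (contDiff_const.add (contDiff_norm_sq ℝ)).rpow_const_of_ne (fun x => by positivity)
  have d1 := norm_iteratedFDeriv_smul_le hJ hg ξ (n := 1) (by norm_num)
  have d2 := norm_iteratedFDeriv_smul_le hJ hg ξ (n := 2) (by norm_num)
  rw [norm_iteratedFDeriv_one] at d1
  rw [norm_it2] at d2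
  simp [Finset.sum_range_succ, -Complex.real_smul, norm_iteratedFDeriv_one, norm_it2] at d1 d2
  have b1 := fderiv_J_le s ξ
  have b2 := fderiv2_J_le s ξ
  have hA : (0:ℝ) ≤ (1 + ‖ξ‖ ^ 2) ^ s := by positivity
  rw [abs_of_nonneg hA] at d1 d2
  unfold Nf
  simp only [norm_smul, Real.norm_eq_abs, abs_of_nonneg hA]
  set A := (1 + ‖ξ‖ ^ 2) ^ s
  set a := ‖g ξ‖
  set b := ‖fderiv ℝ g ξ‖
  set c := ‖fderiv ℝ (fderiv ℝ g) ξ‖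
  have ha : 0 ≤ a := norm_nonneg _
  have hb : 0 ≤ b := norm_nonneg _
  have hc : 0 ≤ c := by positivity
  set p := ‖fderiv ℝ (fun x : En n => (1 + ‖x‖ ^ 2) ^ s) ξ‖
  set r := ‖fderiv ℝ (fderiv ℝ (fun x : En n => (1 + ‖x‖ ^ 2) ^ s)) ξ‖
  have f1 : p * a ≤ 2 * |s| * A * a := by gcongr
  have f2 : 2 * p * b ≤ 2 * (2 * |s| * A) * b := by gcongr
  have f3 : r * a ≤ ((2 * |s| + 4 * |s| * |s - 1|) * A) * a := by gcongr
  have g1 : 0 ≤ |s| := abs_nonneg _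
  have g2 : 0 ≤ |s - 1| := abs_nonneg _
  have k1 : 0 ≤ A * a := by positivity
  have k2 : 0 ≤ A * b := by positivity
  have k3 : 0 ≤ A * c := by positivity
  have k4 : 0 ≤ |s| * (A * a) := by positivity
  have k5 : 0 ≤ |s| * (A * b) := by positivity
  have k6 : 0 ≤ |s| * (A * c) := by positivity
  have k7 : 0 ≤ |s| * |s-1| * (A * a) := by positivity
  have k8 : 0 ≤ |s| * |s-1| * (A * b) := by positivity
  have k9 : 0 ≤ |s| * |s-1| * (A * c) := by positivity
  nlinarith

def Dop {n : ℕ} (a : Option (Fin n)) (f : 𝓢(En n, ℂ)) : 𝓢(En n, ℂ) :=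
  match a with
  | none => f
  | some i => ∂_{(EuclideanSpace.single i (1:ℝ) : En n)} f

lemma clm_norm_le_sum {n : ℕ} {G : Type*} [NormedAddCommGroup G] [NormedSpace ℝ G]
    (L : En n →L[ℝ] G) : ‖L‖ ≤ ∑ i, ‖L (EuclideanSpace.single i (1:ℝ))‖ := by
  refine L.opNorm_le_bound (Finset.sum_nonneg fun i _ => norm_nonneg _) fun x => ?_
  have hx : x = ∑ i, x i • (EuclideanSpace.single i (1:ℝ) : En n) := by
    ext j
    simp [Finset.sum_apply, Pi.single_apply]
  conv_lhs => rw [hx]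
  rw [map_sum, Finset.sum_mul]
  refine (norm_sum_le _ _).trans (Finset.sum_le_sum fun i _ => ?_)
  rw [map_smul, norm_smul, mul_comm]
  gcongr
  exact PiLp.norm_apply_le x i

lemma Nf_le_sum {n : ℕ} (g : 𝓢(En n, ℂ)) (ξ : En n) :
    Nf g ξ ≤ 3 * ∑ p : Option (Fin n) × Option (Fin n), ‖Dop p.1 (Dop p.2 g) ξ‖ := by
  have h0 : ‖g ξ‖ ≤ ∑ p : Option (Fin n) × Option (Fin n), ‖Dop p.1 (Dop p.2 g) ξ‖ :=
    Finset.single_le_sum (f := fun p : Option (Fin n) × Option (Fin n) => ‖Dop p.1 (Dop p.2 g) ξ‖)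
      (fun _ _ => norm_nonneg _) (Finset.mem_univ (none, none))
  have h1 : ‖fderiv ℝ g ξ‖ ≤ ∑ p : Option (Fin n) × Option (Fin n), ‖Dop p.1 (Dop p.2 g) ξ‖ := by
    refine (clm_norm_le_sum _).trans ?_
    rw [Fintype.sum_prod_type, Fintype.sum_option]
    refine le_add_of_le_of_nonneg ?_ (Finset.sum_nonneg fun _ _ => Finset.sum_nonneg fun _ _ => norm_nonneg _)
    rw [Fintype.sum_option]
    exact le_add_of_nonneg_left (norm_nonneg _)
  have h2 : ‖fderiv ℝ (fderiv ℝ g) ξ‖ ≤ ∑ p : Option (Fin n) × Option (Fin n), ‖Dop p.1 (Dop p.2 g) ξ‖ := by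
    refine (clm_norm_le_sum _).trans ?_
    rw [Fintype.sum_prod_type, Fintype.sum_option]
    refine le_add_of_nonneg_of_le (Finset.sum_nonneg fun _ _ => norm_nonneg _) ?_
    refine Finset.sum_le_sum fun i _ => (clm_norm_le_sum _).trans ?_
    rw [Fintype.sum_option]
    refine le_add_of_nonneg_of_le (norm_nonneg _) (Finset.sum_le_sum fun j _ => le_of_eq ?_)
    congr 1
    change _ = fderiv ℝ (fun x => fderiv ℝ g x (EuclideanSpace.single j (1:ℝ))) ξ (EuclideanSpace.single i (1:ℝ))
    have hd : DifferentiableAt ℝ (fderiv ℝ g) ξ :=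
      ((g.smooth 2).fderiv_right (m := 1) (by norm_num)).differentiable (by norm_num) ξ
    rw [fderiv_clm_apply hd (differentiableAt_const _)]
    simp
  unfold Nf
  linarith

def Mop {n : ℕ} (a : Option (Fin n)) (f : 𝓢(En n, ℂ)) : 𝓢(En n, ℂ) :=
  match a with
  | none => f
  | some i => -(2 * π * Complex.I) • SchwartzMap.smulLeftCLM ℂ
      (fun x : En n => inner ℝ x (EuclideanSpace.single i (1:ℝ) : En n)) f

lemma jap_one_le {n : ℕ} (x : En n) : 1 ≤ jap x := by
  rw [jap, Real.one_le_sqrt]; nlinarith [sq_nonneg ‖x‖]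

lemma norm_le_jap {n : ℕ} (x : En n) : ‖x‖ ≤ jap x := by
  rw [jap]; exact Real.le_sqrt_of_sq_le (by linarith)

lemma jap_sq {n : ℕ} (x : En n) : jap x ^ 2 = 1 + ‖x‖ ^ 2 := by
  rw [jap, Real.sq_sqrt (by positivity)]

lemma Dop_fourier {n : ℕ} (a : Option (Fin n)) (u : 𝓢(En n, ℂ)) :
    Dop a (𝓕 u) = 𝓕 (Mop a u) := by
  cases a with
  | none => rfl
  | some i => exact SchwartzMap.lineDerivOp_fourier_eq u _

lemma Mop_le {n : ℕ} (a : Option (Fin n)) (u : 𝓢(En n, ℂ)) (x : En n) :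
    ‖Mop a u x‖ ≤ 2 * π * jap x * ‖u x‖ := by
  have h1 := jap_one_le x
  have hpi := Real.pi_gt_three
  cases a with
  | none =>
    change ‖u x‖ ≤ _
    have : 1 ≤ 2 * π * jap x := by nlinarith
    nlinarith [norm_nonneg (u x)]
  | some i =>
    have e : Mop (some i) u x = -(2 * π * Complex.I) • 
        ((inner ℝ x (EuclideanSpace.single i (1:ℝ) : En n) : ℝ) • u x) := by
      have h : (fun x : En n => inner ℝ x (EuclideanSpace.single i (1:ℝ) : En n)).HasTemperateGrowth := by
        fun_prop
      change (-(2 * π * Complex.I) • SchwartzMap.smulLeftCLM ℂ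
        (fun x : En n => inner ℝ x (EuclideanSpace.single i (1:ℝ) : En n)) u) x = _
      rw [smul_apply, SchwartzMap.smulLeftCLM_apply_apply h]
    rw [e, norm_smul, norm_smul]
    have h2 : ‖(-(2 * π * Complex.I) : ℂ)‖ = 2 * π := by
      simp [abs_of_pos Real.pi_pos]
    rw [h2]
    rw [mul_assoc (2 * π)]
    have h3 : ‖(inner ℝ x (EuclideanSpace.single i (1:ℝ) : En n) : ℝ)‖ ≤ jap x := by
      refine (norm_inner_le_norm _ _).trans ?_
      simp [norm_le_jap]
    gcongr

lemma Mop2_le {n : ℕ} (a b : Option (Fin n)) (u : 𝓢(En n, ℂ)) (x : En n) :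
    ‖Mop a (Mop b u) x‖ ^ 2 ≤ (2 * π) ^ 4 * (jap x ^ (2 * 2 : ℝ) * ‖u x‖ ^ 2) := by
  have h1 := Mop_le a (Mop b u) x
  have h2 := Mop_le b u x
  have h3 := jap_one_le x
  have hpi := Real.pi_pos
  have : ‖Mop a (Mop b u) x‖ ≤ 2 * π * jap x * (2 * π * jap x * ‖u x‖) := h1.trans (by gcongr)
  calc _ ≤ (2 * π * jap x * (2 * π * jap x * ‖u x‖)) ^ 2 := by gcongr
    _ = _ := by
      rw [show (2 * 2 : ℝ) = ((4 : ℕ) : ℝ) by norm_num, Real.rpow_natCast]; ring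

lemma schwartz_sq_integrable {n : ℕ} (u : 𝓢(En n, ℂ)) : Integrable (fun x => ‖u x‖ ^ 2) := by
  have := (u.memLp 2 volume)
  exact this.integrable_norm_pow (by norm_num)

lemma jap4_integrable {n : ℕ} (u : 𝓢(En n, ℂ)) :
    Integrable (fun x => jap x ^ (2 * 2 : ℝ) * ‖u x‖ ^ 2) := by
  have h := schwartz_sq_integrable (SchwartzMap.smulLeftCLM ℂ (fun x : En n => (1 + ‖x‖ ^ 2) ^ (1:ℝ)) u)
  refine h.congr (Eventually.of_forall fun x => ?_)
  have ht := Function.hasTemperateGrowth_one_add_norm_sq_rpow (En n) 1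
  simp only [SchwartzMap.smulLeftCLM_apply_apply ht]
  rw [norm_smul, Real.rpow_one, ← jap_sq, show (2 * 2 : ℝ) = ((4 : ℕ) : ℝ) by norm_num, Real.rpow_natCast,
    norm_pow, Real.norm_eq_abs, sq_abs]
  ring

lemma L2bound (n : ℕ) (β : ℝ) : ∃ C : ℝ, 0 < C ∧ ∀ q : 𝓢(En n, ℂ), ∃ F : En n → ℝ,
    Continuous F ∧ (∀ ξ, 0 ≤ F ξ) ∧ (∀ ξ, Nf (𝓕 (q : En n → ℂ)) ξ ≤ C * jap ξ ^ (-β) * F ξ) ∧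
    ∫⁻ ξ, ENNReal.ofReal (F ξ ^ 2) ≤
      ENNReal.ofReal (C * ∫ x, jap x ^ (2 * 2 : ℝ) * ‖𝓕⁻ (fun ξ => (jap ξ ^ β : ℝ) • 𝓕 (q : En n → ℂ) ξ) x‖ ^ 2) := by
  set P := Option (Fin n) × Option (Fin n)
  set N : ℝ := (Fintype.card P : ℝ)
  set s := -β / 2
  set C1 := (1 + 6 * |s| + (2 * |s| + 4 * |s| * |s - 1|) + 1 + 1) * 3
  set C2 := N * (N * (2 * π) ^ 4)
  have hN : 0 < N := by
    have : 0 < Fintype.card P := Fintype.card_pos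
    exact Nat.cast_pos.mpr this
  have hC1 : 0 < C1 := by positivity
  have hC2 : 0 < C2 := by positivity
  refine ⟨C1 + C2, by positivity, fun q => ?_⟩
  set J : En n → ℝ := fun x => (1 + ‖x‖ ^ 2) ^ (β / 2)
  have hJ : J.HasTemperateGrowth := Function.hasTemperateGrowth_one_add_norm_sq_rpow (En n) (β / 2)
  set g : 𝓢(En n, ℂ) := SchwartzMap.smulLeftCLM ℂ J (𝓕 q)
  have hg : ∀ ξ, g ξ = J ξ • 𝓕 (q : En n → ℂ) ξ := fun ξ => by
    rw [← SchwartzMap.fourier_coe, SchwartzMap.smulLeftCLM_apply_apply hJ]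
  set u : 𝓢(En n, ℂ) := 𝓕⁻ g
  have hu : 𝓕 u = g := by simp [u]
  have hu' : ∀ x, 𝓕⁻ (fun ξ => (jap ξ ^ β : ℝ) • 𝓕 (q : En n → ℂ) ξ) x = u x := by
    intro x
    have : (fun ξ => (jap ξ ^ β : ℝ) • 𝓕 (q : En n → ℂ) ξ) = g := by
      funext ξ; rw [hg, jap_rpow]
    rw [this, ← SchwartzMap.fourierInv_coe]
  simp only [hu']
  refine ⟨fun ξ => ∑ p : P, ‖Dop p.1 (Dop p.2 g) ξ‖, ?_, ?_, ?_, ?_⟩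
  · exact continuous_finsetSum _ fun p _ => (Dop p.1 (Dop p.2 g)).continuous.norm
  · exact fun ξ => Finset.sum_nonneg fun _ _ => norm_nonneg _
  · intro ξ
    have e : (𝓕 (q : En n → ℂ)) = fun ξ => ((1 + ‖ξ‖ ^ 2) ^ s : ℝ) • g ξ := by
      funext ξ
      rw [hg, smul_smul, ← Real.rpow_add (by positivity)]
      simp [s, neg_div]
    rw [e]
    refine (Nf_mul_le s g (g.smooth 2) ξ).trans ?_
    rw [← jap_rpow]
    have h1 := Nf_le_sum g ξ
    have hp : 0 ≤ jap ξ ^ (-β) := by have := jap_one_le ξ; positivity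
    have hS : 0 ≤ ∑ p : P, ‖Dop p.1 (Dop p.2 g) ξ‖ := Finset.sum_nonneg fun _ _ => norm_nonneg _
    calc _ ≤ (1 + 6 * |s| + (2 * |s| + 4 * |s| * |s - 1|) + 1 + 1) * jap ξ ^ (-β) * 
          (3 * ∑ p : P, ‖Dop p.1 (Dop p.2 g) ξ‖) := by gcongr
      _ = C1 * jap ξ ^ (-β) * ∑ p : P, ‖Dop p.1 (Dop p.2 g) ξ‖ := by simp only [C1]; ring
      _ ≤ _ := by gcongr; linarith
  · have hD : ∀ p : P, Dop p.1 (Dop p.2 g) = 𝓕 (Mop p.1 (Mop p.2 u)) := fun p => by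
      rw [← hu, Dop_fourier, Dop_fourier]
    set I := ∫ x, jap x ^ (2 * 2 : ℝ) * ‖u x‖ ^ 2
    have hI0 : 0 ≤ I := integral_nonneg fun x => by have := jap_one_le x; positivity
    have hp : ∀ p : P, ∫ ξ, ‖Dop p.1 (Dop p.2 g) ξ‖ ^ 2 ≤ (2 * π) ^ 4 * I := fun p => by
      rw [hD, SchwartzMap.integral_norm_sq_fourier, ← integral_const_mul]
      exact integral_mono (schwartz_sq_integrable _) ((jap4_integrable u).const_mul _)
        fun x => Mop2_le _ _ _ _
    have hIntg : Integrable (fun ξ => N * ∑ p : P, ‖Dop p.1 (Dop p.2 g) ξ‖ ^ 2) :=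
      (integrable_finsetSum _ fun p _ => schwartz_sq_integrable _).const_mul _
    calc _ ≤ ∫⁻ ξ, ENNReal.ofReal (N * ∑ p : P, ‖Dop p.1 (Dop p.2 g) ξ‖ ^ 2) := by
          refine lintegral_mono fun ξ => ENNReal.ofReal_le_ofReal ?_
          exact sq_sum_le_card_mul_sum_sq
      _ = ENNReal.ofReal (∫ ξ, N * ∑ p : P, ‖Dop p.1 (Dop p.2 g) ξ‖ ^ 2) :=
          (ofReal_integral_eq_lintegral_ofReal hIntg (Eventually.of_forall fun ξ => by positivity)).symm
      _ ≤ _ := by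
          refine ENNReal.ofReal_le_ofReal ?_
          rw [integral_const_mul, integral_finsetSum _ fun p _ => schwartz_sq_integrable _]
          calc _ ≤ N * ∑ p : P, (2 * π) ^ 4 * I := by gcongr with p; exact hp p
            _ = C2 * I := by simp [C2, N]; ring
            _ ≤ _ := by gcongr; linarith

lemma Nf_continuous {n : ℕ} {h : En n → ℂ} (hh : ContDiff ℝ 2 h) : Continuous (Nf h) := by
  have h1 : ContDiff ℝ 1 (fderiv ℝ h) := hh.fderiv_right (by norm_num)
  have h2 : ContDiff ℝ 0 (fderiv ℝ (fderiv ℝ h)) := h1.fderiv_right (by norm_num)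
  have h3 : Continuous (fun ξ => ‖fderiv ℝ (fderiv ℝ h) ξ‖) := by
    simp only [← norm_it2]
    exact (hh.continuous_iteratedFDeriv (m := 2) (by norm_num)).norm
  unfold Nf
  exact (hh.continuous.norm.add h1.continuous.norm).add h3

lemma Nf_nonneg {n : ℕ} (h : En n → ℂ) (ξ : En n) : 0 ≤ Nf h ξ := by
  unfold Nf; positivity

/-- derivatives along a line -/
lemma line_deriv {n : ℕ} {h : En n → ℂ} (hh : ContDiff ℝ 2 h) (c v : En n) {k : ℝ} (hv : ‖v‖ ≤ k)
    (hk : 1 ≤ k) :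
    ∃ g1 g2 : ℝ → ℂ, Continuous g1 ∧ Continuous g2 ∧
      (∀ s, HasDerivAt (fun s : ℝ => h (c + s • v)) (g1 s) s) ∧
      (∀ s, HasDerivAt g1 (g2 s) s) ∧
      (∀ s, ‖g1 s‖ ≤ k * Nf h (c + s • v)) ∧ (∀ s, ‖g2 s‖ ≤ k ^ 2 * Nf h (c + s • v)) := by
  have h1 : ContDiff ℝ 1 (fderiv ℝ h) := hh.fderiv_right (by norm_num)
  have h2 : ContDiff ℝ 0 (fderiv ℝ (fderiv ℝ h)) := h1.fderiv_right (by norm_num)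
  have hl : ∀ s : ℝ, HasDerivAt (fun s : ℝ => c + s • v) v s := fun s => by
    simpa using ((hasDerivAt_id s).smul_const v).const_add c
  have hlc : Continuous (fun s : ℝ => c + s • v) := by fun_prop
  refine ⟨fun s => fderiv ℝ h (c + s • v) v, fun s => fderiv ℝ (fderiv ℝ h) (c + s • v) v v,
    ?_, ?_, ?_, ?_, ?_, ?_⟩
  · exact (h1.continuous.comp hlc).clm_apply continuous_const
  · exact ((h2.continuous.comp hlc).clm_apply continuous_const).clm_apply continuous_const
  · intro s
    exact ((hh.differentiable (by norm_num) _).hasFDerivAt).comp_hasDerivAt s (hl s)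
  · intro s
    have := ((h1.differentiable (by norm_num) (c + s • v)).hasFDerivAt).comp_hasDerivAt s (hl s)
    have h3 := this.clm_apply (hasDerivAt_const s v)
    simpa using h3
  · intro s
    refine (ContinuousLinearMap.le_opNorm _ _).trans ?_
    rw [mul_comm]
    have : ‖fderiv ℝ h (c + s • v)‖ ≤ Nf h (c + s • v) := by
      unfold Nf; linarith [norm_nonneg (h (c + s • v)), norm_nonneg (fderiv ℝ (fderiv ℝ h) (c + s • v))]
    gcongr
  · intro s
    refine (ContinuousLinearMap.le_opNorm _ _).trans ?_
    have h4 := ContinuousLinearMap.le_opNorm (fderiv ℝ (fderiv ℝ h) (c + s • v)) v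
    have : ‖fderiv ℝ (fderiv ℝ h) (c + s • v)‖ ≤ Nf h (c + s • v) := by
      unfold Nf; linarith [norm_nonneg (h (c + s • v)), norm_nonneg (fderiv ℝ h (c + s • v))]
    have h5 := Nf_nonneg h (c + s • v)
    calc _ ≤ (Nf h (c + s • v) * k) * k := by
          gcongr
          exact h4.trans (by gcongr)
      _ = _ := by ring

/-- sup bound -/
lemma sup_bound {g g' : ℝ → ℂ} {M : ℝ → ℝ} (hg : ∀ s, HasDerivAt g (g' s) s) (hg' : Continuous g')
    (hM : Continuous M) (h1 : ∀ s, ‖g s‖ ≤ M s) (h2 : ∀ s, ‖g' s‖ ≤ M s) {a b : ℝ} (hab : a < b)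
    {x : ℝ} (hx : x ∈ Icc a b) : ‖g x‖ ≤ ((b - a)⁻¹ + 1) * ∫ s in a..b, M s := by
  have hM0 : ∀ s, 0 ≤ M s := fun s => (norm_nonneg _).trans (h1 s)
  have key : ∀ y ∈ Icc a b, ‖g x‖ ≤ M y + ∫ s in a..b, M s := by
    intro y hy
    have e : ∫ s in y..x, g' s = g x - g y :=
      intervalIntegral.integral_eq_sub_of_hasDerivAt (fun s _ => hg s) (hg'.intervalIntegrable _ _)
    have e2 : ‖∫ s in y..x, g' s‖ ≤ ∫ s in a..b, M s := by
      refine intervalIntegral.norm_integral_le_integral_norm_uIoc.trans ?_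
      rw [intervalIntegral.integral_of_le hab.le]
      have hsub : uIoc y x ⊆ Ioc a b := by
        intro t ht
        rw [uIoc, mem_Ioc] at ht
        exact ⟨lt_of_le_of_lt (le_min hy.1 hx.1) ht.1, ht.2.trans (max_le hy.2 hx.2)⟩
      calc _ ≤ ∫ s in uIoc y x, M s := by
            refine setIntegral_mono (hg'.norm.integrableOn_uIoc) (hM.integrableOn_uIoc) h2
        _ ≤ _ := setIntegral_mono_set hM.integrableOn_Ioc (Eventually.of_forall hM0)
            (LE.le.eventuallyLE hsub)
    have e3 : g x = g y + ∫ s in y..x, g' s := by rw [e]; ring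
    rw [e3]
    exact (norm_add_le _ _).trans (add_le_add (h1 y) e2)
  have hIntg : ∫ y in a..b, ‖g x‖ ≤ ∫ y in a..b, (M y + ∫ s in a..b, M s) :=
    intervalIntegral.integral_mono_on hab.le (by simp) ((hM.add continuous_const).intervalIntegrable _ _) key
  rw [intervalIntegral.integral_add (hM.intervalIntegrable _ _) (by simp)] at hIntg
  simp only [intervalIntegral.integral_const, smul_eq_mul] at hIntg
  have hba : 0 < b - a := sub_pos.2 hab
  rw [← sub_nonneg]
  have : 0 ≤ (b - a)⁻¹ * (((∫ s in a..b, M s) + (b - a) * ∫ s in a..b, M s) - (b - a) * ‖g x‖) :=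
    mul_nonneg (by positivity) (by linarith)
  convert this using 1
  field_simp

lemma rho_lip (m : ℕ) : ∃ L : ℝ, 0 < L ∧ ∀ r ∈ Icc (0:ℝ) 2, |1 ^ m / (1 + 1) - r ^ m / (r + 1)| ≤ L * |1 - r| ∧
    |r ^ m / (r + 1)| ≤ L := by
  refine ⟨1 + 2 * (m * 2 ^ (m - 1)) + 2 ^ m, by positivity, fun r hr => ?_⟩
  have hr1 : 0 < r + 1 := by linarith [hr.1]
  constructor
  · have h1 := abs_pow_sub_pow_le 1 r m
    have h2 : max |(1:ℝ)| |r| ≤ 2 := by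
      rw [abs_of_nonneg hr.1]; simp [hr.2]
    have h3 : |1 ^ m - r ^ m| ≤ |1 - r| * (m * 2 ^ (m - 1)) := by
      refine h1.trans ?_
      rw [mul_assoc]
      gcongr
    have e : (1:ℝ) ^ m / (1 + 1) - r ^ m / (r + 1) = ((r - 1) + 2 * (1 ^ m - r ^ m)) / (2 * (r + 1)) := by
      field_simp; simp; ring
    rw [e, abs_div, abs_of_pos (by positivity : 0 < 2 * (r + 1)), div_le_iff₀ (by positivity)]
    have h4 : |(r - 1) + 2 * (1 ^ m - r ^ m)| ≤ (1 + 2 * (m * 2 ^ (m - 1))) * |1 - r| := by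
      refine (abs_add_le _ _).trans ?_
      rw [abs_mul, abs_two, abs_sub_comm r 1]
      linarith
    refine h4.trans ?_
    have h5 : (1 + 2 * (m * 2 ^ (m - 1))) * |1 - r| ≤ (1 + 2 * (m * 2 ^ (m - 1)) + 2 ^ m) * |1 - r| := by
      exact mul_le_mul_of_nonneg_right (le_add_of_nonneg_right (by positivity)) (abs_nonneg _)
    refine h5.trans (le_mul_of_one_le_right (by positivity) (by linarith [hr.1]))
  · rw [abs_of_nonneg (div_nonneg (pow_nonneg hr.1 _) hr1.le), div_le_iff₀ hr1]
    have h1 : r ^ m ≤ 2 ^ m := pow_le_pow_left₀ hr.1 hr.2 m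
    have h2 : (0:ℝ) ≤ 1 + 2 * (m * 2 ^ (m - 1)) := by positivity
    have h3 : (0:ℝ) ≤ 2 ^ m := by positivity
    nlinarith [hr.1]

lemma phi_diff (m : ℕ) (δ : ℝ) (hδ0 : 0 < δ) (hδ1 : δ < 1) : ∃ C : ℝ, 0 < C ∧
    ∀ {n : ℕ} (h : En n → ℂ) (_ : ContDiff ℝ 2 h) (η c v : En n) (k : ℝ) (_ : ‖v‖ ≤ k) (_ : 1 ≤ k)
      (r : ℝ) (_ : |1 - r| ≤ δ),
      ‖((1:ℝ) ^ m / (1 + 1)) • (h (c + (1:ℝ) • v) * h (η - (c + (1:ℝ) • v))) -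
        (r ^ m / (r + 1)) • (h (c + r • v) * h (η - (c + r • v)))‖ ≤
      |1 - r| * (C * k ^ 2 * ∫ s in (1 - δ)..(1 + δ), Nf h (c + s • v) * Nf h (η - (c + s • v))) := by
  obtain ⟨L, hL, hρ⟩ := rho_lip m
  refine ⟨2 * L * (((1 + δ) - (1 - δ))⁻¹ + 1) * 4, ?_, ?_⟩
  · have : 0 < (1 + δ) - (1 - δ) := by linarith
    positivity
  intro n h hh η c v k hv hk r hr
  obtain ⟨a1, a2, ca1, ca2, da1, da2, ba1, ba2⟩ := line_deriv hh c v hv hk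
  obtain ⟨b1, b2, cb1, cb2, db1, db2, bb1, bb2⟩ := line_deriv hh (η - c) (-v) (by rwa [norm_neg]) hk
  have er : ∀ s : ℝ, (η - c) + s • (-v) = η - (c + s • v) := fun s => by
    rw [smul_neg]; abel
  simp only [er] at db1 bb1 bb2
  set A : ℝ → ℝ := fun s => Nf h (c + s • v) with hA
  set B : ℝ → ℝ := fun s => Nf h (η - (c + s • v)) with hB
  set a0 : ℝ → ℂ := fun s => h (c + s • v) with ha0
  set b0 : ℝ → ℂ := fun s => h (η - (c + s • v)) with hb0
  have hNc := Nf_continuous hh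
  have hAc : Continuous A := hNc.comp (by fun_prop)
  have hBc : Continuous B := hNc.comp (by fun_prop)
  have cb0 : Continuous b0 := hh.continuous.comp (by fun_prop)
  have ca0 : Continuous a0 := hh.continuous.comp (by fun_prop)
  have hA0 : ∀ s, 0 ≤ A s := fun s => Nf_nonneg _ _
  have hB0 : ∀ s, 0 ≤ B s := fun s => Nf_nonneg _ _
  have hN : ∀ ξ, ‖h ξ‖ ≤ Nf h ξ := fun ξ => by
    unfold Nf; linarith [norm_nonneg (fderiv ℝ h ξ), norm_nonneg (fderiv ℝ (fderiv ℝ h) ξ)]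
  have ba0 : ∀ s, ‖a0 s‖ ≤ A s := fun s => hN _
  have bb0 : ∀ s, ‖b0 s‖ ≤ B s := fun s => hN _
  set M : ℝ → ℝ := fun s => 4 * k ^ 2 * (A s * B s) with hM
  have hMc : Continuous M := by fun_prop
  have hk2 : k ≤ k ^ 2 := by nlinarith
  have G0 : ∀ s, ‖a0 s * b0 s‖ ≤ M s := fun s => by
    rw [norm_mul]
    have : ‖a0 s‖ * ‖b0 s‖ ≤ A s * B s := mul_le_mul (ba0 s) (bb0 s) (norm_nonneg _) (hA0 s)
    have h2 : 0 ≤ A s * B s := mul_nonneg (hA0 s) (hB0 s)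
    refine this.trans (le_mul_of_one_le_left h2 (by nlinarith))
  have G1 : ∀ s, ‖a1 s * b0 s + a0 s * b1 s‖ ≤ M s := fun s => by
    refine (norm_add_le _ _).trans ?_
    rw [norm_mul, norm_mul]
    have t1 : ‖a1 s‖ * ‖b0 s‖ ≤ (k * A s) * B s := mul_le_mul (ba1 s) (bb0 s) (norm_nonneg _) (by have := hA0 s; positivity)
    have t2 : ‖a0 s‖ * ‖b1 s‖ ≤ A s * (k * B s) := mul_le_mul (ba0 s) (bb1 s) (norm_nonneg _) (hA0 s)
    have h2 : 0 ≤ A s * B s := mul_nonneg (hA0 s) (hB0 s)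
    have h3 : k * (A s * B s) ≤ k ^ 2 * (A s * B s) := by gcongr
    have h4 : 0 ≤ k ^ 2 * (A s * B s) := by positivity
    simp only [hM]; nlinarith
  have G2 : ∀ s, ‖(a2 s * b0 s + a1 s * b1 s) + (a1 s * b1 s + a0 s * b2 s)‖ ≤ M s := fun s => by
    refine (norm_add_le _ _).trans ((add_le_add (norm_add_le _ _) (norm_add_le _ _)).trans ?_)
    simp only [norm_mul]
    have t1 : ‖a2 s‖ * ‖b0 s‖ ≤ (k ^ 2 * A s) * B s := mul_le_mul (ba2 s) (bb0 s) (norm_nonneg _) (by have := hA0 s; positivity)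
    have t2 : ‖a0 s‖ * ‖b2 s‖ ≤ A s * (k ^ 2 * B s) := mul_le_mul (ba0 s) (bb2 s) (norm_nonneg _) (hA0 s)
    have t3 : ‖a1 s‖ * ‖b1 s‖ ≤ (k * A s) * (k * B s) := mul_le_mul (ba1 s) (bb1 s) (norm_nonneg _) (by have := hA0 s; positivity)
    simp only [hM]; nlinarith
  have dG : ∀ s, HasDerivAt (fun s => a0 s * b0 s) (a1 s * b0 s + a0 s * b1 s) s := fun s =>
    (da1 s).mul (db1 s)
  have dG' : ∀ s, HasDerivAt (fun s => a1 s * b0 s + a0 s * b1 s)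
      ((a2 s * b0 s + a1 s * b1 s) + (a1 s * b1 s + a0 s * b2 s)) s := fun s =>
    ((da2 s).mul (db1 s)).add ((da1 s).mul (db2 s))
  set K := ((1 + δ) - (1 - δ))⁻¹ + 1 with hK
  have hlt : 1 - δ < 1 + δ := by linarith
  have s0 := fun x hx => sup_bound (x := x) dG (by fun_prop) hMc G0 G1 hlt hx
  have s1 := fun x hx => sup_bound (x := x) dG' (by fun_prop) hMc G1 G2 hlt hx
  set T := ∫ s in (1 - δ)..(1 + δ), M s with hT
  have hr' := abs_le.1 hr
  have hrI : r ∈ Icc (1 - δ) (1 + δ) := ⟨by linarith, by linarith⟩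
  have h1I : (1:ℝ) ∈ Icc (1 - δ) (1 + δ) := ⟨by linarith, by linarith⟩
  have hmv : ‖a0 1 * b0 1 - a0 r * b0 r‖ ≤ (K * T) * ‖1 - r‖ :=
    (convex_Icc (1 - δ) (1 + δ)).norm_image_sub_le_of_norm_hasDerivWithin_le
      (fun x _ => (dG x).hasDerivWithinAt) s1 hrI h1I
  obtain ⟨hρ1, hρ2⟩ := hρ r ⟨by linarith, by linarith⟩
  have hT' : T = 4 * k ^ 2 * ∫ s in (1 - δ)..(1 + δ), A s * B s := by
    rw [hT, hM, intervalIntegral.integral_const_mul]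
  have hKT : 0 ≤ K * T := (norm_nonneg _).trans (s0 1 h1I)
  change ‖((1:ℝ) ^ m / (1 + 1)) • (a0 1 * b0 1) - (r ^ m / (r + 1)) • (a0 r * b0 r)‖ ≤ _
  have e : ((1:ℝ) ^ m / (1 + 1)) • (a0 1 * b0 1) - (r ^ m / (r + 1)) • (a0 r * b0 r) =
    ((1:ℝ) ^ m / (1 + 1) - r ^ m / (r + 1)) • (a0 1 * b0 1) + (r ^ m / (r + 1)) • (a0 1 * b0 1 - a0 r * b0 r) := by
    rw [sub_smul, smul_sub]; abel
  rw [e]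
  refine (norm_add_le _ _).trans ?_
  rw [norm_smul, norm_smul]
  rw [Real.norm_eq_abs] at hmv ⊢
  rw [Real.norm_eq_abs]
  have u1 : |(1:ℝ) ^ m / (1 + 1) - r ^ m / (r + 1)| * ‖a0 1 * b0 1‖ ≤ (L * |1 - r|) * (K * T) :=
    mul_le_mul hρ1 (s0 1 h1I) (norm_nonneg _) (by positivity)
  have u2 : |r ^ m / (r + 1)| * ‖a0 1 * b0 1 - a0 r * b0 r‖ ≤ L * ((K * T) * |1 - r|) :=
    mul_le_mul hρ2 hmv (norm_nonneg _) (by positivity)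
  calc _ ≤ (L * |1 - r|) * (K * T) + L * ((K * T) * |1 - r|) := add_le_add u1 u2
    _ = _ := by rw [hT']; ring

lemma lintegral_scale (m : ℕ) {k : ℝ} (hk : 0 < k) (c : En (m+1)) (G : En (m+1) → ℝ≥0∞) (hG : Measurable G) :
    ∫⁻ x, G (c + k • x) = ENNReal.ofReal ((k ^ (m+1))⁻¹) * ∫⁻ x, G x := by
  have h1 : ∫⁻ x, G (c + k • x) = ∫⁻ y, G (c + y) ∂(Measure.map (fun x : En (m+1) => k • x) volume) := by
    rw [lintegral_map (f := fun y => G (c + y)) (hG.comp (measurable_const_add c)) (measurable_const_smul k)]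
  rw [h1, Measure.map_addHaar_smul _ hk.ne', lintegral_smul_measure]
  simp only [finrank_euclideanSpace, Fintype.card_fin, smul_eq_mul]
  rw [abs_of_pos (by positivity), lintegral_add_left_eq_self G c]

lemma Sop_eq (m : ℕ) (θ η : En (m+1)) (q : En (m+1) → ℂ) (hη : ⟪η, θ⟫ < 0) (hk : 1 ≤ kval θ η) {r : ℝ} (hr : 0 < r) :
    Sop θ r q η = (kval θ η ^ m / kval θ η) • ∫ ω in sphere (0 : En (m+1)) 1,
      (r ^ m / (r + 1)) • (𝓕 q (-(kval θ η • θ) + r • (kval θ η • ω)) *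
        𝓕 q (η - (-(kval θ η • θ) + r • (kval θ η • ω)))) ∂μH[(m:ℝ)] := by
  have hm : (((m + 1 : ℕ) : ℝ) - 1) = (m : ℝ) := by push_cast; ring
  have hk0 : 0 < kval θ η := by linarith
  rw [Sop, if_pos hη, hm, ewald, sphere_integral_scale m _ (mul_pos hr hk0) (fun ξ => 𝓕 q ξ * 𝓕 q (η - ξ)),
    integral_smul, smul_smul, smul_smul]
  simp only [smul_smul]
  congr 1
  rw [mul_pow]
  field_simp

lemma Sdiff (m : ℕ) (δ : ℝ) (hδ0 : 0 < δ) (hδ1 : δ < 1) : ∃ C : ℝ≥0∞, C ≠ ∞ ∧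
    ∀ θ : En (m+1), ‖θ‖ = 1 → ∀ q : 𝓢(En (m+1), ℂ), ∀ η, ⟪η, θ⟫ < 0 → 1 ≤ kval θ η → ∀ r, |1 - r| ≤ δ →
    ‖Sop θ 1 q η - Sop θ r q η‖ₑ ≤ ENNReal.ofReal |1 - r| * (C *
      ∫⁻ ξ in closedBall 0 (3 * kval θ η), ENNReal.ofReal (Nf (𝓕 (q : En (m+1) → ℂ)) ξ * Nf (𝓕 (q : En (m+1) → ℂ)) (η - ξ))) := by
  obtain ⟨C1, hC1, hphi⟩ := phi_diff m δ hδ0 hδ1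
  obtain ⟨C2, hC2, hpol⟩ := polar_ineq m δ hδ1
  refine ⟨ENNReal.ofReal C1 * C2, ENNReal.mul_ne_top ENNReal.ofReal_ne_top hC2, ?_⟩
  intro θ hθ q η hη hk r hr
  have hr' := abs_le.1 hr
  have hr0 : 0 < r := by linarith
  rw [Sop_eq m θ η q hη hk one_pos, Sop_eq m θ η q hη hk hr0, ← smul_sub]
  set k := kval θ η with hkdef
  have hk0 : 0 < k := by linarith
  set h : En (m+1) → ℂ := 𝓕 (q : En (m+1) → ℂ) with hh
  have hsm : ContDiff ℝ 2 h := by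
    rw [hh, ← SchwartzMap.fourier_coe]; exact (𝓕 q).smooth 2
  set c := -(k • θ) with hc
  have hcn : ‖c‖ = k := by rw [hc, norm_neg, norm_smul, hθ, Real.norm_eq_abs, abs_of_pos hk0, mul_one]
  set H : En (m+1) → ℝ := fun ξ => Nf h ξ * Nf h (η - ξ) with hH
  have hNc := Nf_continuous hsm
  have hHc : Continuous H := hNc.mul (hNc.comp (by fun_prop))
  have hH0 : ∀ ξ, 0 ≤ H ξ := fun ξ => mul_nonneg (Nf_nonneg _ _) (Nf_nonneg _ _)
  have hIntg : ∀ s : ℝ, IntegrableOn (fun ω => (s ^ m / (s + 1)) • (h (c + s • (k • ω)) * h (η - (c + s • (k • ω)))))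
      (sphere (0 : En (m+1)) 1) μH[(m:ℝ)] := by
    intro s
    have hcont : Continuous (fun ω => (s ^ m / (s + 1)) • (h (c + s • (k • ω)) * h (η - (c + s • (k • ω))))) := by
      have := hsm.continuous
      fun_prop
    obtain ⟨B, hB⟩ := (isCompact_sphere (0 : En (m+1)) 1).exists_bound_of_continuousOn hcont.continuousOn
    refine Measure.integrableOn_of_bounded (M := B) (hausdorff_sphere_lt_top m).ne hcont.aestronglyMeasurable ?_
    exact (ae_restrict_iff' isClosed_sphere.measurableSet).2 (Eventually.of_forall hB)
  rw [← integral_sub (hIntg 1) (hIntg r), enorm_smul]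
  have e1 : ‖∫ ω in sphere (0 : En (m+1)) 1, ((1:ℝ) ^ m / (1 + 1)) • (h (c + (1:ℝ) • (k • ω)) * h (η - (c + (1:ℝ) • (k • ω)))) -
      (r ^ m / (r + 1)) • (h (c + r • (k • ω)) * h (η - (c + r • (k • ω)))) ∂μH[(m:ℝ)]‖ₑ ≤
      ∫⁻ ω in sphere (0 : En (m+1)) 1, (ENNReal.ofReal (|1 - r| * (C1 * k ^ 2)) *
        (∫⁻ s in Icc (1 - δ) (1 + δ), (closedBall (0 : En (m+1)) 2).indicator (fun x => ENNReal.ofReal (H (c + k • x))) (s • ω))) ∂μH[(m:ℝ)] := by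
    refine (enorm_integral_le_lintegral_enorm _).trans ?_
    refine setLIntegral_mono' isClosed_sphere.measurableSet fun ω hω => ?_
    have hωn : ‖ω‖ = 1 := by simpa using hω
    have := hphi h hsm η c (k • ω) k (by rw [norm_smul, hωn, Real.norm_eq_abs, abs_of_pos hk0, mul_one]) hk r hr
    rw [← ofReal_norm]
    refine (ENNReal.ofReal_le_ofReal this).trans (le_of_eq ?_)
    rw [← mul_assoc, ENNReal.ofReal_mul (by positivity)]
    congr 1
    have hcs : Continuous fun s : ℝ => H (c + s • (k • ω)) := hHc.comp (by fun_prop)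
    have : ∀ s ∈ Icc (1 - δ) (1 + δ), (closedBall (0 : En (m+1)) 2).indicator (fun x => ENNReal.ofReal (H (c + k • x))) (s • ω)
        = ENNReal.ofReal (H (c + s • (k • ω))) := by
      intro s hs
      rw [indicator_of_mem, smul_comm]
      rw [mem_closedBall_zero_iff, norm_smul, hωn, mul_one, Real.norm_eq_abs, abs_le]
      constructor <;> linarith [hs.1, hs.2]
    rw [setLIntegral_congr_fun measurableSet_Icc this, intervalIntegral.integral_of_le (by linarith),
      ← integral_Icc_eq_integral_Ioc]
    exact ofReal_integral_eq_lintegral_ofReal hcs.integrableOn_Icc (Eventually.of_forall fun s => hH0 _)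
  have hmeas : Measurable ((closedBall (0 : En (m+1)) 2).indicator (fun x => ENNReal.ofReal (H (c + k • x)))) := by
    refine Measurable.indicator ?_ measurableSet_closedBall
    exact (ENNReal.continuous_ofReal.comp (hHc.comp (by fun_prop))).measurable
  have hGm : Measurable ((closedBall (0 : En (m+1)) (3 * k)).indicator (fun x => ENNReal.ofReal (H x))) := by
    refine Measurable.indicator ?_ measurableSet_closedBall
    exact (ENNReal.continuous_ofReal.comp hHc).measurable
  have e2 := hpol _ hmeas
  have e3 : ∫⁻ x, (closedBall (0 : En (m+1)) 2).indicator (fun x => ENNReal.ofReal (H (c + k • x))) x ≤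
      ENNReal.ofReal ((k ^ (m+1))⁻¹) * ∫⁻ ξ in closedBall 0 (3 * k), ENNReal.ofReal (H ξ) := by
    rw [← lintegral_indicator measurableSet_closedBall, ← lintegral_scale m hk0 c _ hGm]
    refine lintegral_mono fun x => ?_
    by_cases hx : x ∈ closedBall (0 : En (m+1)) 2
    · rw [indicator_of_mem hx, indicator_of_mem]
      rw [mem_closedBall_zero_iff] at hx ⊢
      refine (norm_add_le _ _).trans ?_
      rw [hcn, norm_smul, Real.norm_eq_abs, abs_of_pos hk0]
      nlinarith
    · rw [indicator_of_notMem hx]; exact zero_le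
  rw [lintegral_const_mul' _ _ ENNReal.ofReal_ne_top] at e1
  have hq : ‖k ^ m / k‖ₑ = ENNReal.ofReal (k ^ m / k) := by
    rw [← ofReal_norm, Real.norm_eq_abs, abs_of_pos (by positivity)]
  set I := ∫⁻ ξ in closedBall 0 (3 * k), ENNReal.ofReal (H ξ)
  calc _ ≤ ENNReal.ofReal (k ^ m / k) * (ENNReal.ofReal (|1 - r| * (C1 * k ^ 2)) * (C2 * (ENNReal.ofReal ((k ^ (m+1))⁻¹) * I))) := by
        rw [hq]
        gcongr
        refine e1.trans ?_
        gcongr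
        exact e2.trans (by gcongr)
    _ = ENNReal.ofReal (k ^ m / k * (|1 - r| * (C1 * k ^ 2)) * (k ^ (m+1))⁻¹) * (C2 * I) := by
        rw [ENNReal.ofReal_mul (p := k ^ m / k * (|1 - r| * (C1 * k ^ 2))) (by positivity),
          ENNReal.ofReal_mul (p := k ^ m / k) (by positivity)]
        ring
    _ = ENNReal.ofReal (|1 - r| * C1) * (C2 * I) := by
        congr 2
        field_simp
        ring
    _ = _ := by
        rw [ENNReal.ofReal_mul (by positivity)]
        ring

lemma lintegral_cs {X : Type*} [MeasurableSpace X] {μ : Measure X} {f g : X → ℝ≥0∞}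
    (hf : AEMeasurable f μ) (hg : AEMeasurable g μ) :
    (∫⁻ x, f x * g x ∂μ) ^ 2 ≤ (∫⁻ x, f x ^ 2 ∂μ) * ∫⁻ x, g x ^ 2 ∂μ := by
  have h := ENNReal.lintegral_mul_le_Lp_mul_Lq μ Real.HolderConjugate.two_two hf hg
  have h2 : (∫⁻ x, f x * g x ∂μ) ^ 2 ≤ ((∫⁻ x, f x ^ (2:ℝ) ∂μ) ^ (1 / (2:ℝ)) * (∫⁻ x, g x ^ (2:ℝ) ∂μ) ^ (1 / (2:ℝ))) ^ 2 := by
    gcongr; exact h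
  refine h2.trans (le_of_eq ?_)
  rw [mul_pow]
  have e : ∀ a : ℝ≥0∞, (a ^ (1 / (2:ℝ))) ^ 2 = a := fun a => by
    rw [← ENNReal.rpow_natCast, ← ENNReal.rpow_mul]; norm_num
  rw [e, e]
  simp only [ENNReal.rpow_two]

lemma jap_le_one_add {n : ℕ} (x : En n) : jap x ≤ 1 + ‖x‖ := by
  rw [jap]; refine Real.sqrt_le_iff.2 ⟨by positivity, by nlinarith [norm_nonneg x]⟩

lemma jap_add_le {n : ℕ} (x y : En n) : jap (x + y) ≤ jap x + jap y := by
  have h1 := jap_one_le x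
  have h2 := jap_one_le y
  rw [jap]
  refine Real.sqrt_le_iff.2 ⟨by positivity, ?_⟩
  have h3 := jap_sq x
  have h4 := jap_sq y
  have h5 := norm_add_le x y
  have h6 : ‖x‖ * ‖y‖ ≤ jap x * jap y := mul_le_mul (norm_le_jap x) (norm_le_jap y) (norm_nonneg _) (by linarith)
  have h7 : ‖x + y‖ ^ 2 ≤ (‖x‖ + ‖y‖) ^ 2 := by gcongr
  nlinarith

lemma jap_continuous {n : ℕ} : Continuous (jap : En n → ℝ) := by
  unfold jap; fun_prop

lemma ptw_half {a b j k β γ p : ℝ} (ha : 1 ≤ a) (hb : 1 ≤ b) (hj : 1 ≤ j) (hbj : j / 2 ≤ b) (hak : a ≤ 5 * k)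
    (hβ : 0 ≤ β) (hγ : γ ≤ β) (he : 0 ≤ p - γ) (hk : 1 ≤ k) :
    a ^ (-β) * b ^ (-β) ≤ (2 ^ β * 5 ^ (p - γ)) * (j ^ (-β) * k ^ (p - γ)) * a ^ (-p) := by
  have a0 : 0 < a := by linarith
  have h1 : b ^ (-β) ≤ 2 ^ β * j ^ (-β) := by
    calc b ^ (-β) ≤ (j / 2) ^ (-β) := Real.rpow_le_rpow_of_nonpos (by positivity) hbj (by linarith)
      _ = _ := by
        rw [Real.div_rpow (by linarith) (by norm_num), Real.rpow_neg (by norm_num : (0:ℝ) ≤ 2)]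
        field_simp
  have h2 : a ^ (-β) ≤ a ^ (-p) * (5 ^ (p - γ) * k ^ (p - γ)) := by
    calc a ^ (-β) ≤ a ^ (-γ) := Real.rpow_le_rpow_of_exponent_le ha (by linarith)
      _ = a ^ (-p) * a ^ (p - γ) := by rw [← Real.rpow_add a0]; congr 1; ring
      _ ≤ a ^ (-p) * (5 * k) ^ (p - γ) := by gcongr
      _ = _ := by rw [Real.mul_rpow (by norm_num) (by linarith)]
  calc _ ≤ (a ^ (-p) * (5 ^ (p - γ) * k ^ (p - γ))) * (2 ^ β * j ^ (-β)) := by gcongr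
    _ = _ := by ring

lemma ptw {a b j k β γ p : ℝ} (ha : 1 ≤ a) (hb : 1 ≤ b) (hj : 1 ≤ j) (hab : j ≤ a + b) (hak : a ≤ 5 * k)
    (hbk : b ≤ 5 * k)
    (hβ : 0 ≤ β) (hγ : γ ≤ β) (he : 0 ≤ p - γ) (hk : 1 ≤ k) :
    a ^ (-β) * b ^ (-β) ≤ (2 ^ β * 5 ^ (p - γ)) * (j ^ (-β) * k ^ (p - γ)) * (a ^ (-p) + b ^ (-p)) := by
  have h0 : 0 ≤ (2 ^ β * 5 ^ (p - γ)) * (j ^ (-β) * k ^ (p - γ)) := by positivity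
  have h1 : 0 ≤ a ^ (-p) := by positivity
  have h2 : 0 ≤ b ^ (-p) := by positivity
  by_cases h : j / 2 ≤ b
  · refine (ptw_half ha hb hj h hak hβ hγ he hk).trans ?_
    gcongr; linarith
  · have h' : j / 2 ≤ a := by linarith
    rw [mul_comm]
    refine (ptw_half hb ha hj h' hbk hβ hγ he hk).trans ?_
    gcongr; linarith

lemma W_fin (n : ℕ) : ∫⁻ x : En n, ENNReal.ofReal (jap x ^ (-(((n:ℝ) + 1) / 2))) ^ 2 ≠ ∞ := by
  have h : Integrable (fun x : En n => (1 + ‖x‖ ^ 2) ^ (-((n:ℝ) + 1) / 2)) :=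
    integrable_rpow_neg_one_add_norm_sq (by simp)
  have e : ∀ x : En n, ENNReal.ofReal (jap x ^ (-(((n:ℝ) + 1) / 2))) ^ 2 = ENNReal.ofReal ((1 + ‖x‖ ^ 2) ^ (-((n:ℝ) + 1) / 2)) := by
    intro x
    rw [← ENNReal.ofReal_pow (by have := jap_one_le x; positivity), jap_rpow, ← Real.rpow_natCast, ← Real.rpow_mul (by positivity)]
    congr 2
    push_cast; ring
  simp only [e]
  exact h.lintegral_lt_top.ne

/-- Cauchy-Schwarz bound for the ball integral -/
lemma ball_bound (n : ℕ) {β γ C1 : ℝ} (hβ : 0 ≤ β) (hγ : γ ≤ β) (he : 0 ≤ ((n:ℝ) + 1) / 2 - γ) (hC1 : 0 < C1)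
    (N F : En n → ℝ) (hN0 : ∀ ξ, 0 ≤ N ξ) (hF0 : ∀ ξ, 0 ≤ F ξ) (hFc : Continuous F)
    (hNF : ∀ ξ, N ξ ≤ C1 * jap ξ ^ (-β) * F ξ) (η : En n) {k : ℝ} (hk : 1 ≤ k) (hηk : ‖η‖ ≤ k) :
    (∫⁻ ξ in closedBall 0 (3 * k), ENNReal.ofReal (N ξ * N (η - ξ))) ^ 2 ≤
      ENNReal.ofReal (C1 ^ 2 * (2 ^ β * 5 ^ (((n:ℝ) + 1) / 2 - γ)) * (jap η ^ (-β) * k ^ (((n:ℝ) + 1) / 2 - γ))) ^ 2 *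
      ((4 * ∫⁻ x : En n, ENNReal.ofReal (jap x ^ (-(((n:ℝ) + 1) / 2))) ^ 2) *
        ∫⁻ ξ, ENNReal.ofReal (F ξ ^ 2) * ENNReal.ofReal (F (η - ξ) ^ 2)) := by
  set p := ((n:ℝ) + 1) / 2
  set D := C1 ^ 2 * (2 ^ β * 5 ^ (p - γ)) * (jap η ^ (-β) * k ^ (p - γ))
  have hjη := jap_one_le η
  have hD : 0 ≤ D := by positivity
  set w : En n → ℝ≥0∞ := fun ξ => ENNReal.ofReal (jap ξ ^ (-p)) with hw
  set f : En n → ℝ≥0∞ := fun ξ => ENNReal.ofReal (F ξ) with hf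
  have hwc : Measurable w := by
    refine (ENNReal.continuous_ofReal.comp (jap_continuous.rpow_const fun x => Or.inl ?_)).measurable
    have := jap_one_le x; positivity
  have hfc : Measurable f := (ENNReal.continuous_ofReal.comp hFc).measurable
  have hsub : Measurable (fun ξ : En n => η - ξ) := by fun_prop
  have h1 : ∫⁻ ξ in closedBall 0 (3 * k), ENNReal.ofReal (N ξ * N (η - ξ)) ≤
      ENNReal.ofReal D * ∫⁻ ξ, (w ξ + w (η - ξ)) * (f ξ * f (η - ξ)) := by
    rw [← lintegral_const_mul' _ _ ENNReal.ofReal_ne_top]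
    refine le_trans ?_ (setLIntegral_le_lintegral (closedBall 0 (3 * k)) _)
    refine setLIntegral_mono' measurableSet_closedBall fun ξ hξ => ?_
    have hξn : ‖ξ‖ ≤ 3 * k := by simpa using hξ
    have a1 := jap_one_le ξ
    have b1 := jap_one_le (η - ξ)
    have hP := ptw (p := p) a1 b1 hjη (by simpa using jap_add_le ξ (η - ξ)) ((jap_le_one_add ξ).trans (by linarith))
      ((jap_le_one_add (η - ξ)).trans (by linarith [norm_sub_le η ξ])) hβ hγ he hk
    have : N ξ * N (η - ξ) ≤ D * ((jap ξ ^ (-p) + jap (η - ξ) ^ (-p)) * (F ξ * F (η - ξ))) := by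
      have f0 := hF0 ξ
      have f1 := hF0 (η - ξ)
      calc _ ≤ (C1 * jap ξ ^ (-β) * F ξ) * (C1 * jap (η - ξ) ^ (-β) * F (η - ξ)) :=
            mul_le_mul (hNF _) (hNF _) (hN0 _) (by positivity)
        _ = C1 ^ 2 * (F ξ * F (η - ξ)) * (jap ξ ^ (-β) * jap (η - ξ) ^ (-β)) := by ring
        _ ≤ C1 ^ 2 * (F ξ * F (η - ξ)) * ((2 ^ β * 5 ^ (p - γ)) * (jap η ^ (-β) * k ^ (p - γ)) * (jap ξ ^ (-p) + jap (η - ξ) ^ (-p))) := by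
            gcongr
        _ = _ := by simp only [D]; ring
    refine (ENNReal.ofReal_le_ofReal this).trans (le_of_eq ?_)
    rw [ENNReal.ofReal_mul hD, ENNReal.ofReal_mul (p := jap ξ ^ (-p) + jap (η - ξ) ^ (-p)) (by positivity), ENNReal.ofReal_add (by positivity) (by positivity),
      ENNReal.ofReal_mul (hF0 _)]
  have h2 := lintegral_cs (μ := (volume : Measure (En n))) (f := fun ξ => w ξ + w (η - ξ)) (g := fun ξ => f ξ * f (η - ξ))
    (hwc.add (hwc.comp hsub)).aemeasurable (hfc.mul (hfc.comp hsub)).aemeasurable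
  have h3 : ∫⁻ ξ, (w ξ + w (η - ξ)) ^ 2 ≤ 4 * ∫⁻ x, w x ^ 2 := by
    have e : ∀ a b : ℝ≥0∞, (a + b) ^ 2 ≤ 2 * a ^ 2 + 2 * b ^ 2 := fun a b => by
      have := ENNReal.rpow_add_le_mul_rpow_add_rpow a b (p := 2) (by norm_num)
      norm_num at this
      rwa [mul_add] at this
    calc _ ≤ ∫⁻ ξ, (2 * w ξ ^ 2 + 2 * w (η - ξ) ^ 2) := lintegral_mono fun ξ => e _ _
      _ = 2 * (∫⁻ ξ, w ξ ^ 2) + 2 * ∫⁻ ξ, w (η - ξ) ^ 2 := by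
        rw [lintegral_add_left ((hwc.pow_const 2).const_mul 2), lintegral_const_mul' _ _ (by norm_num),
          lintegral_const_mul' _ _ (by norm_num)]
      _ = _ := by
        rw [lintegral_sub_left_eq_self (fun x => w x ^ 2) η]
        ring
  calc _ ≤ (ENNReal.ofReal D * ∫⁻ ξ, (w ξ + w (η - ξ)) * (f ξ * f (η - ξ))) ^ 2 := by gcongr
    _ = ENNReal.ofReal D ^ 2 * (∫⁻ ξ, (w ξ + w (η - ξ)) * (f ξ * f (η - ξ))) ^ 2 := mul_pow _ _ _
    _ ≤ ENNReal.ofReal D ^ 2 * ((4 * ∫⁻ x, w x ^ 2) * ∫⁻ ξ, (f ξ * f (η - ξ)) ^ 2) := by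
        gcongr
        exact h2.trans (by gcongr)
    _ = _ := by
        congr 2
        refine lintegral_congr fun ξ => ?_
        rw [mul_pow, ENNReal.ofReal_pow (hF0 _), ENNReal.ofReal_pow (hF0 _)]

lemma Q_int (n : ℕ) (F : En n → ℝ≥0∞) (hF : Measurable F) :
    ∫⁻ η, ∫⁻ ξ, F ξ * F (η - ξ) = (∫⁻ ξ, F ξ) ^ 2 := by
  rw [lintegral_lintegral_swap]
  · have : ∀ ξ : En n, ∫⁻ η, F ξ * F (η - ξ) = F ξ * ∫⁻ η, F η := fun ξ => by
      rw [lintegral_const_mul (f := fun η => F (η - ξ)) _ (hF.comp (by fun_prop)), lintegral_sub_right_eq_self F ξ]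
    simp only [this]
    rw [lintegral_mul_const _ hF, sq]
  · refine Measurable.aemeasurable ?_
    exact (hF.comp measurable_snd).mul (hF.comp (measurable_fst.sub measurable_snd))

lemma kval_ge {n : ℕ} (θ η : En n) (hθ : ‖θ‖ = 1) (hη : ⟪η, θ⟫ < 0) : ‖η‖ ≤ kval θ η := by
  have h1 : ⟪θ, η⟫ < 0 := by rwa [real_inner_comm]
  have h2 := abs_real_inner_le_norm θ η
  rw [hθ, one_mul, abs_of_neg h1] at h2
  rw [kval, ← neg_div_neg_eq, neg_neg, le_div_iff₀ (by linarith)]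
  nlinarith [norm_nonneg η]

lemma exp_bound {j k α β e : ℝ} (hj : 1 ≤ j) (hk : j / 2 ≤ k) (he : 2 * e - 4 ≤ 0)
    (hα : 2 * α - 2 * β + (2 * e - 4) ≤ 0) :
    j ^ (2 * α) * ((k ^ 2)⁻¹) ^ 2 * (j ^ (-β) * k ^ e) ^ 2 ≤ 2 ^ (4 - 2 * e) := by
  have hj0 : 0 < j := by linarith
  have hk0 : 0 < k := by linarith
  have e1 : j ^ (2 * α) * ((k ^ 2)⁻¹) ^ 2 * (j ^ (-β) * k ^ e) ^ 2 = j ^ (2 * α - 2 * β) * k ^ (2 * e - 4) := by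
    have a1 : j ^ (2 * α - 2 * β) = j ^ (2 * α) * (j ^ (-β)) ^ 2 := by
      rw [← Real.rpow_natCast (j ^ (-β)), ← Real.rpow_mul hj0.le, ← Real.rpow_add hj0]; congr 1; push_cast; ring
    have a2 : k ^ (2 * e - 4) = ((k ^ 2)⁻¹) ^ 2 * (k ^ e) ^ 2 := by
      rw [← Real.rpow_natCast (k ^ e), ← Real.rpow_mul hk0.le, Real.rpow_sub hk0,
        show (4:ℝ) = ((4:ℕ):ℝ) by norm_num, Real.rpow_natCast]
      rw [mul_comm 2 e]; push_cast; field_simp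
    rw [a1, a2]; ring
  rw [e1]
  calc _ ≤ j ^ (2 * α - 2 * β) * (j / 2) ^ (2 * e - 4) :=
        mul_le_mul_of_nonneg_left (Real.rpow_le_rpow_of_nonpos (by positivity) hk he) (by positivity)
    _ = j ^ (2 * α - 2 * β + (2 * e - 4)) * 2 ^ (4 - 2 * e) := by
        rw [Real.div_rpow hj0.le (by norm_num), Real.rpow_add hj0, show (4 - 2 * e) = -(2 * e - 4) by ring,
          Real.rpow_neg (by norm_num : (0:ℝ) ≤ 2)]
        field_simp
    _ ≤ 1 * 2 ^ (4 - 2 * e) := by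
        gcongr
        exact Real.rpow_le_one_of_one_le_of_nonpos hj hα
    _ = _ := one_mul _

lemma main_aux (m : ℕ) (β δ C₀ α γ : ℝ)
    (hβ : 0 ≤ β) (hδ0 : 0 < δ) (hδ1 : δ < 1) (hC₀ : 1 < C₀)
    (χ : En (m+1) → ℝ) (hχ : IsCutoff C₀ χ) (hγβ : γ ≤ β) (he0 : 0 ≤ (((m+1 : ℕ):ℝ) + 1) / 2 - γ)
    (he1 : 2 * ((((m+1 : ℕ):ℝ) + 1) / 2 - γ) - 4 ≤ 0)
    (hα : 2 * α - 2 * β + (2 * ((((m+1 : ℕ):ℝ) + 1) / 2 - γ) - 4) ≤ 0) :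
    ∃ C : ℝ, 0 < C ∧ ∀ θ : En (m+1), ‖θ‖ = 1 → ∀ q : 𝓢(En (m+1), ℂ),
      (∫ η : En (m+1), jap η ^ (2 * α) *
          ‖(if ⟪η, θ⟫ < 0 then
              ∫ r in {r : ℝ | 0 < r ∧ |1 - r| < δ * min ((kval θ η ^ 2)⁻¹) 1},
                ((1 - r)⁻¹ : ℝ) •
                  ((χ η : ℝ) • Sop θ 1 ⇑q η - (χ η : ℝ) • Sop θ r ⇑q η)
            else 0)‖ ^ 2)
        ≤ C * δ ^ 2 * sobNorm β 2 ⇑q ^ 4 := by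
  obtain ⟨C1, hC1, hL2⟩ := L2bound (m+1) β
  obtain ⟨C2, hC2, hS⟩ := Sdiff m δ hδ0 hδ1
  set e := (((m+1 : ℕ):ℝ) + 1) / 2 - γ with hedef
  set W := ∫⁻ x : En (m+1), ENNReal.ofReal (jap x ^ (-((((m+1:ℕ):ℝ) + 1) / 2))) ^ 2 with hWdef
  have hW : W ≠ ∞ := W_fin (m+1)
  set D := C1 ^ 2 * (2 ^ β * 5 ^ e) with hDdef
  have hD : 0 < D := by positivity
  set K : ℝ≥0∞ := ENNReal.ofReal ((2 * δ) ^ 2 * D ^ 2 * 2 ^ (4 - 2 * e)) * C2 ^ 2 * (4 * W) with hKdef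
  have hK : K ≠ ∞ := by
    refine ENNReal.mul_ne_top (ENNReal.mul_ne_top ENNReal.ofReal_ne_top (ENNReal.pow_ne_top hC2)) 
      (ENNReal.mul_ne_top (by norm_num) hW)
  refine ⟨K.toReal * C1 ^ 2 / δ ^ 2 + 1, by positivity, fun θ hθ q => ?_⟩
  obtain ⟨F, hFc, hF0, hNF, hFI⟩ := hL2 q
  set I := ∫ x, jap x ^ (2 * 2 : ℝ) * ‖𝓕⁻ (fun ξ => (jap ξ ^ β : ℝ) • 𝓕 (q : En (m+1) → ℂ) ξ) x‖ ^ 2 with hI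
  have hI0 : 0 ≤ I := integral_nonneg fun x => by have := jap_one_le x; positivity
  have hsob : sobNorm β 2 (q : En (m+1) → ℂ) ^ 4 = I ^ 2 := by
    rw [sobNorm, ← hI, ← Real.rpow_natCast, ← Real.rpow_mul hI0]
    norm_num
  set Q : En (m+1) → ℝ≥0∞ := fun η => ∫⁻ ξ, ENNReal.ofReal (F ξ ^ 2) * ENNReal.ofReal (F (η - ξ) ^ 2) with hQ
  have hQI : ∫⁻ η, Q η ≤ ENNReal.ofReal (C1 * I) ^ 2 := by
    rw [hQ, Q_int (m+1) (fun ξ => ENNReal.ofReal (F ξ ^ 2)) (hFc.measurable.pow_const 2).ennreal_ofReal]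
    gcongr
  set T : En (m+1) → ℝ := fun η => jap η ^ (2 * α) *
          ‖(if ⟪η, θ⟫ < 0 then
              ∫ r in {r : ℝ | 0 < r ∧ |1 - r| < δ * min ((kval θ η ^ 2)⁻¹) 1},
                ((1 - r)⁻¹ : ℝ) •
                  ((χ η : ℝ) • Sop θ 1 ⇑q η - (χ η : ℝ) • Sop θ r ⇑q η)
            else 0)‖ ^ 2 with hT
  have key : ∀ η, ‖T η‖ₑ ≤ K * Q η := by
    intro η
    by_cases hη : ⟪η, θ⟫ < 0
    swap
    · simp [hT, hη]
    by_cases hχη : χ η = 0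
    · simp [hT, hχη]
    have hηC : C₀ ≤ ‖η‖ := by
      by_contra h
      exact hχη (hχ.eq_zero η (not_le.1 h))
    have hηk := kval_ge θ η hθ hη
    simp only [hT, if_pos hη]
    set k := kval θ η with hkdef
    have hk1 : 1 ≤ k := by linarith
    have hk0 : 0 < k := by linarith
    have hj := jap_one_le η
    have hj2 : jap η / 2 ≤ k := by linarith [jap_le_one_add η]
    set B := ∫⁻ ξ in closedBall 0 (3 * k), ENNReal.ofReal (Nf (𝓕 (q : En (m+1) → ℂ)) ξ * Nf (𝓕 (q : En (m+1) → ℂ)) (η - ξ)) with hB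
    have hBB := ball_bound (m+1) hβ hγβ he0 hC1 (Nf (𝓕 (q : En (m+1) → ℂ))) F (Nf_nonneg _) hF0 hFc hNF η hk1 hηk
    rw [← hB, ← hWdef, ← hedef, ← hDdef] at hBB
    have hmin : min ((k ^ 2)⁻¹) 1 ≤ (k ^ 2)⁻¹ := min_le_left _ _
    have hmin1 : min ((k ^ 2)⁻¹) 1 ≤ 1 := min_le_right _ _
    set R := {r : ℝ | 0 < r ∧ |1 - r| < δ * min ((k ^ 2)⁻¹) 1} with hR
    have hRm : MeasurableSet R := by
      have h1 : MeasurableSet {r : ℝ | 0 < r} := measurableSet_lt measurable_const measurable_id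
      have h2 : MeasurableSet {r : ℝ | |1 - r| < δ * min ((k ^ 2)⁻¹) 1} :=
        (isOpen_lt (by fun_prop) continuous_const).measurableSet
      exact h1.inter h2
    have hRv : volume R ≤ ENNReal.ofReal (2 * δ * (k ^ 2)⁻¹) := by
      have : R ⊆ Icc (1 - δ * (k ^ 2)⁻¹) (1 + δ * (k ^ 2)⁻¹) := by
        intro r hr
        have h1 : |1 - r| < δ * (k ^ 2)⁻¹ := lt_of_lt_of_le hr.2 (by gcongr)
        have := abs_lt.1 h1
        constructor <;> linarith
      refine (measure_mono this).trans (le_of_eq ?_)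
      rw [Real.volume_Icc]; congr 1; ring
    have hin : ‖∫ r in R, ((1 - r)⁻¹ : ℝ) • ((χ η : ℝ) • Sop θ 1 ⇑q η - (χ η : ℝ) • Sop θ r ⇑q η)‖ₑ ≤
        (C2 * B) * ENNReal.ofReal (2 * δ * (k ^ 2)⁻¹) := by
      refine (enorm_integral_le_lintegral_enorm _).trans ?_
      calc _ ≤ ∫⁻ r in R, C2 * B := by
            refine setLIntegral_mono' hRm fun r hr => ?_
            have hrδ : |1 - r| ≤ δ := hr.2.le.trans (mul_le_of_le_one_right hδ0.le hmin1)
            have h1 := hS θ hθ q η hη hk1 r hrδ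
            rw [← smul_sub, enorm_smul, enorm_smul]
            have hχ1 : ‖χ η‖ₑ ≤ 1 := by
              rw [← ofReal_norm, Real.norm_eq_abs, abs_of_nonneg (hχ.mem_Icc η).1]
              exact ENNReal.ofReal_le_one.2 (hχ.mem_Icc η).2
            have h2 : ‖(1 - r)⁻¹‖ₑ * ENNReal.ofReal |1 - r| ≤ 1 := by
              rw [← ofReal_norm, ← ENNReal.ofReal_mul (norm_nonneg _), norm_inv, Real.norm_eq_abs]
              exact ENNReal.ofReal_le_one.2 (inv_mul_le_one)
            calc _ ≤ ‖(1 - r)⁻¹‖ₑ * (1 * (ENNReal.ofReal |1 - r| * (C2 * B))) := by gcongr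
              _ = (‖(1 - r)⁻¹‖ₑ * ENNReal.ofReal |1 - r|) * (C2 * B) := by ring
              _ ≤ 1 * (C2 * B) := by gcongr
              _ = _ := one_mul _
        _ = (C2 * B) * volume R := by rw [setLIntegral_const]
        _ ≤ _ := by gcongr
    rw [enorm_mul, enorm_pow, enorm_norm]
    have hje : ‖jap η ^ (2 * α)‖ₑ = ENNReal.ofReal (jap η ^ (2 * α)) := by
      rw [← ofReal_norm, Real.norm_eq_abs, abs_of_nonneg (by positivity)]
    rw [hje]
    calc _ ≤ ENNReal.ofReal (jap η ^ (2 * α)) * ((C2 * B) * ENNReal.ofReal (2 * δ * (k ^ 2)⁻¹)) ^ 2 := by gcongr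
      _ = ENNReal.ofReal (jap η ^ (2 * α)) * ENNReal.ofReal (2 * δ * (k ^ 2)⁻¹) ^ 2 * C2 ^ 2 * B ^ 2 := by ring
      _ ≤ ENNReal.ofReal (jap η ^ (2 * α)) * ENNReal.ofReal (2 * δ * (k ^ 2)⁻¹) ^ 2 * C2 ^ 2 * 
          (ENNReal.ofReal (D * (jap η ^ (-β) * k ^ e)) ^ 2 * (4 * W * Q η)) := by gcongr
      _ = ENNReal.ofReal (jap η ^ (2 * α) * (2 * δ * (k ^ 2)⁻¹) ^ 2 * (D * (jap η ^ (-β) * k ^ e)) ^ 2) * C2 ^ 2 * (4 * W) * Q η := by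
          rw [ENNReal.ofReal_mul (p := jap η ^ (2 * α) * (2 * δ * (k ^ 2)⁻¹) ^ 2) (by positivity),
            ENNReal.ofReal_mul (p := jap η ^ (2 * α)) (by positivity), ENNReal.ofReal_pow (by positivity),
            ENNReal.ofReal_pow (by positivity)]
          ring
      _ ≤ _ := by
          have hreal : jap η ^ (2 * α) * (2 * δ * (k ^ 2)⁻¹) ^ 2 * (D * (jap η ^ (-β) * k ^ e)) ^ 2
              ≤ (2 * δ) ^ 2 * D ^ 2 * 2 ^ (4 - 2 * e) := by
            calc _ = (2 * δ) ^ 2 * D ^ 2 *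
                  (jap η ^ (2 * α) * ((k ^ 2)⁻¹) ^ 2 * (jap η ^ (-β) * k ^ e) ^ 2) := by ring
              _ ≤ _ := mul_le_mul_of_nonneg_left (exp_bound hj hj2 he1 hα) (by positivity)
          have h' := ENNReal.ofReal_le_ofReal hreal
          rw [hKdef]
          exact mul_le_mul' (mul_le_mul' (mul_le_mul' h' le_rfl) le_rfl) le_rfl
  have hfin : ‖∫ η, T η‖ₑ ≤ ENNReal.ofReal (K.toReal * (C1 * I) ^ 2) := by
    refine (enorm_integral_le_lintegral_enorm _).trans ((lintegral_mono key).trans ?_)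
    rw [lintegral_const_mul' _ _ hK, ENNReal.ofReal_mul ENNReal.toReal_nonneg, ENNReal.ofReal_toReal hK,
      ENNReal.ofReal_pow (by positivity)]
    gcongr
  rw [← ofReal_norm, ENNReal.ofReal_le_ofReal_iff (by positivity)] at hfin
  rw [hsob]
  refine (Real.le_norm_self _).trans (hfin.trans ?_)
  have : (K.toReal * C1 ^ 2 / δ ^ 2 + 1) * δ ^ 2 * I ^ 2 = K.toReal * (C1 * I) ^ 2 + δ ^ 2 * I ^ 2 := by
    field_simp
  rw [this]
  have : 0 ≤ δ ^ 2 * I ^ 2 := by positivity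
  linarith


/-- Estimate for the operator `P_{θ,δ_k}` from the proof of Proposition 4.1:
`∫ ⟨η⟩^{2α} |∫_{|1-r| < δ_k} (S̃_{θ,1}(q)(η) - S̃_{θ,r}(q)(η))/(1-r) dr|² dη
  ≤ C δ² ‖q‖⁴_{W^{β,2}_2}`, where `δ_k = δ min(k⁻², 1)`. -/
theorem near_singularity_principal_value_estimate (n : ℕ) (hn : 2 ≤ n) (β δ C₀ α : ℝ)
    (hβ : 0 ≤ β) (hδ0 : 0 < δ) (hδ1 : δ < 1) (hC₀ : 1 < C₀)
    (χ : En n → ℝ) (hχ : IsCutoff C₀ χ)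
    (hα : (((n : ℝ) - 3) / 2 < β ∧ β < ((n : ℝ) - 1) / 2 ∧
            α ≤ 2 * β - ((n : ℝ) - 3) / 2) ∨
          (((n : ℝ) - 1) / 2 ≤ β ∧ α < β + 1)) :
    ∃ C : ℝ, 0 < C ∧ ∀ θ : En n, ‖θ‖ = 1 → ∀ q : 𝓢(En n, ℂ),
      (∫ η : En n, jap η ^ (2 * α) *
          ‖(if ⟪η, θ⟫ < 0 then
              ∫ r in {r : ℝ | 0 < r ∧ |1 - r| < δ * min ((kval θ η ^ 2)⁻¹) 1},
                ((1 - r)⁻¹ : ℝ) •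
                  ((χ η : ℝ) • Sop θ 1 ⇑q η - (χ η : ℝ) • Sop θ r ⇑q η)
            else 0)‖ ^ 2)
        ≤ C * δ ^ 2 * sobNorm β 2 ⇑q ^ 4 := by
  obtain ⟨m, rfl⟩ : ∃ m, n = m + 1 := ⟨n - 1, by omega⟩
  rcases hα with ⟨h1, h2, h3⟩ | ⟨h1, h2⟩
  · exact main_aux m β δ C₀ α β hβ hδ0 hδ1 hC₀ χ hχ le_rfl (by linarith) (by linarith) (by linarith)
  · exact main_aux m β δ C₀ α ((((m+1 : ℕ):ℝ) - 1) / 2) hβ hδ0 hδ1 hC₀ χ hχ h1 (by linarith) (by linarith) (by linarith)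

end
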